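/- arXiv:2509.07536 — 2 statements merged into one kernel-verified Lean document; each statement's English description precedes it below -/
import Mathlib

section
/- Let ω be a radial weight in the class D = D̂∩Ď, let 1<q<∞, q'=q/(q−1), and set h(r)=ω̂(r)^{−1/(q·q')} for 0≤r<1. Then there exists a constant C>0 such that for all 0≤r<1: ∫_0^1 h(s)^{q'}·M_1(s, B^ω_r)·s·ω(s) ds ≤ C·h(r)^{q'}, and for all 0≤s<1: ∫_0^1 h(r)^{q}·M_1(r, B^ω_s)·r·ω(r) dr ≤ C·h(s)^{q}. -/
open MeasureTheory Filter Set
open scoped ENNReal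

noncomputable section

/-- `ω̂(r) = ∫_r^1 ω(s) ds`. -/
def omegaHat (ω : ℝ → ℝ) (r : ℝ) : ℝ := ∫ s in r..1, ω s

/-- A radial weight: nonnegative and Lebesgue integrable on `[0,1)`. -/
def IsRadialWeight (ω : ℝ → ℝ) : Prop :=
  (∀ r ∈ Set.Ico (0:ℝ) 1, 0 ≤ ω r) ∧ MeasureTheory.IntegrableOn ω (Set.Ico 0 1)

/-- The class `D̂` of upper doubling radial weights. -/
def InDhat (ω : ℝ → ℝ) : Prop :=
  ∃ C > (0:ℝ), ∀ r ∈ Set.Ico (0:ℝ) 1, omegaHat ω r ≤ C * omegaHat ω ((1 + r) / 2)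

/-- The class `Ď`. -/
def InDcheck (ω : ℝ → ℝ) : Prop :=
  ∃ K > (1:ℝ), ∃ C > (1:ℝ), ∀ r ∈ Set.Ico (0:ℝ) 1,
    C * omegaHat ω (1 - (1 - r) / K) ≤ omegaHat ω r

/-- Moments `μ_x = ∫_0^1 r^x μ(r) dr`. -/
def momentW (μ : ℝ → ℝ) (x : ℝ) : ℝ := ∫ r in (0:ℝ)..1, r ^ x * μ r

/-- The coefficients `μ_{2k+1}` of the `A²_μ` pairing. -/
def momentCoeff (μ : ℝ → ℝ) : ℕ → ℝ := fun k => momentW μ (2 * (k:ℝ) + 1)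

/-- The point `r e^{iθ}` of the circle of radius `r`. -/
def circlePt (r θ : ℝ) : ℂ := (r:ℂ) * Complex.exp ((θ:ℂ) * Complex.I)

/-- Integral means `M_p(r,f)` (with values in `[0,∞]`). -/
def MpE (p r : ℝ) (f : ℂ → ℂ) : ℝ≥0∞ :=
  (ENNReal.ofReal (1 / (2 * Real.pi)) *
    ∫⁻ θ in Set.Ioo (0:ℝ) (2 * Real.pi), ENNReal.ofReal (‖f (circlePt r θ)‖ ^ p)) ^ (1 / p)

/-- Integral means of a `[0,∞]`-valued function. -/
def MpEE (p r : ℝ) (F : ℂ → ℝ≥0∞) : ℝ≥0∞ :=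
  (ENNReal.ofReal (1 / (2 * Real.pi)) *
    ∫⁻ θ in Set.Ioo (0:ℝ) (2 * Real.pi), (F (circlePt r θ)) ^ p) ^ (1 / p)

/-- The norm of the mixed norm space `L^{p,q}_ω`. -/
def LpqNormE (ω : ℝ → ℝ) (p q : ℝ) (f : ℂ → ℂ) : ℝ≥0∞ :=
  (∫⁻ r in Set.Ioo (0:ℝ) 1, (MpE p r f) ^ q * ENNReal.ofReal (r * ω r)) ^ (1 / q)

/-- The `L^{p,q}_ω` norm of a `[0,∞]`-valued function. -/
def LpqNormEE (ω : ℝ → ℝ) (p q : ℝ) (F : ℂ → ℝ≥0∞) : ℝ≥0∞ :=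
  (∫⁻ r in Set.Ioo (0:ℝ) 1, (MpEE p r F) ^ q * ENNReal.ofReal (r * ω r)) ^ (1 / q)

/-- The norm of `A^{p,∞}_ω` : `sup_{0 ≤ r < 1} M_p(r,f) ω̂(r)`. -/
def ApInfNormE (ω : ℝ → ℝ) (p : ℝ) (f : ℂ → ℂ) : ℝ≥0∞ :=
  ⨆ r ∈ Set.Ico (0:ℝ) 1, MpE p r f * ENNReal.ofReal (omegaHat ω r)

/-- Membership in the mixed norm space `A^{p,q}_ω`. -/
def InApq (ω : ℝ → ℝ) (p q : ℝ) (f : ℂ → ℂ) : Prop :=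
  DifferentiableOn ℂ f (Metric.ball 0 1) ∧ LpqNormE ω p q f < ⊤

/-- Membership in `A^{p,∞}_ω`. -/
def InApInf (ω : ℝ → ℝ) (p : ℝ) (f : ℂ → ℂ) : Prop :=
  DifferentiableOn ℂ f (Metric.ball 0 1) ∧ ApInfNormE ω p f < ⊤

/-- Taylor coefficient of `f` at `0`. -/
def taylorCoeff (f : ℂ → ℂ) (n : ℕ) : ℂ := iteratedDeriv n f 0 / (n.factorial : ℂ)

/-- The pairing `⟨f,g⟩ = lim_{r→1⁻} ∑_k f̂(k) conj(ĝ(k)) c(k) r^k` exists and equals `l`. -/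
def HasPairingC (c : ℕ → ℝ) (f g : ℂ → ℂ) (l : ℂ) : Prop :=
  (∀ r ∈ Set.Ico (0:ℝ) 1, Summable (fun k : ℕ =>
    taylorCoeff f k * (starRingEnd ℂ) (taylorCoeff g k) * ((c k : ℝ) : ℂ) * ((r:ℂ)) ^ k)) ∧
  Filter.Tendsto (fun r : ℝ => ∑' k : ℕ,
    taylorCoeff f k * (starRingEnd ℂ) (taylorCoeff g k) * ((c k : ℝ) : ℂ) * ((r:ℂ)) ^ k)
    (nhdsWithin 1 (Set.Iio 1)) (nhds l)

/-- `L` is linear on the functions satisfying `P`. -/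
def IsLinearOn (P : (ℂ → ℂ) → Prop) (L : (ℂ → ℂ) → ℂ) : Prop :=
  (∀ f g : ℂ → ℂ, P f → P g → L (f + g) = L f + L g) ∧
  (∀ (c : ℂ) (f : ℂ → ℂ), P f → L (c • f) = c * L f)

/-- Dilation `f_r(z) = f(rz)`. -/
def dilateF (f : ℂ → ℂ) (r : ℝ) : ℂ → ℂ := fun z => f ((r:ℂ) * z)

/-- The BMOA norm `|f(0)| + sup_{a∈D} sup_{0<r<1} M₂(r, f∘φ_a - f(a))`. -/
def BMOANormE (f : ℂ → ℂ) : ℝ≥0∞ :=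
  ENNReal.ofReal ‖f 0‖ +
    ⨆ a ∈ Metric.ball (0:ℂ) 1, ⨆ r ∈ Set.Ioo (0:ℝ) 1,
      MpE 2 r (fun z => f ((a - z) / (1 - (starRingEnd ℂ) a * z)) - f a)

/-- The Bloch norm `|f(0)| + sup_{z∈D} (1-|z|²)|f'(z)|`. -/
def BlochNormE (f : ℂ → ℂ) : ℝ≥0∞ :=
  ENNReal.ofReal ‖f 0‖ +
    ⨆ z ∈ Metric.ball (0:ℂ) 1, ENNReal.ofReal ((1 - ‖z‖ ^ 2) * ‖deriv f z‖)

/-- The norm of `X(q,ω)`: `(∫_0^1 ‖f_r‖_X^q ω(r) dr)^{1/q}`. -/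
def XqNormE (Xnorm : (ℂ → ℂ) → ℝ≥0∞) (ω : ℝ → ℝ) (q : ℝ) (f : ℂ → ℂ) : ℝ≥0∞ :=
  (∫⁻ r in Set.Ioo (0:ℝ) 1, (Xnorm (dilateF f r)) ^ q * ENNReal.ofReal (ω r)) ^ (1 / q)

/-- The norm of `X(∞,ω)`: `sup_{0<r<1} ‖f_r‖_X ω̂(r)`. -/
def XInfNormE (Xnorm : (ℂ → ℂ) → ℝ≥0∞) (ω : ℝ → ℝ) (f : ℂ → ℂ) : ℝ≥0∞ :=
  ⨆ r ∈ Set.Ioo (0:ℝ) 1, Xnorm (dilateF f r) * ENNReal.ofReal (omegaHat ω r)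

/-- The standard radial weight `ν_β(r) = (β+1)(1-r²)^β`. -/
def nuWeight (β : ℝ) : ℝ → ℝ := fun r => (β + 1) * (1 - r ^ 2) ^ β

/-- The Bergman reproducing kernel `B^ω_a(z) = ∑ (z conj a)^n / (2 ω_{2n+1})`. -/
def bergmanKernel (ω : ℝ → ℝ) (a z : ℂ) : ℂ :=
  ∑' n : ℕ, (z * (starRingEnd ℂ) a) ^ n / (2 * ((momentW ω (2 * (n:ℝ) + 1) : ℝ) : ℂ))

/-- The Bergman projection (`dA` is normalized area measure). -/
def PomegaProj (ω : ℝ → ℝ) (f : ℂ → ℂ) (z : ℂ) : ℂ :=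
  (Real.pi)⁻¹ • ∫ ζ in Metric.ball (0:ℂ) 1,
    f ζ * (starRingEnd ℂ) (bergmanKernel ω z ζ) * ((ω ‖ζ‖ : ℝ) : ℂ)

/-- The maximal Bergman projection applied to `|f|`, with values in `[0,∞]`. -/
def PomegaPlusL (ω : ℝ → ℝ) (f : ℂ → ℂ) (z : ℂ) : ℝ≥0∞ :=
  ∫⁻ ζ in Metric.ball (0:ℂ) 1,
    ENNReal.ofReal (‖f ζ‖ * ‖bergmanKernel ω z ζ‖ * ω ‖ζ‖ / Real.pi)

/-- The Hardy `H¹` norm. -/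
def H1NormE (f : ℂ → ℂ) : ℝ≥0∞ := ⨆ r ∈ Set.Ioo (0:ℝ) 1, MpE 1 r f

/-- `r_n = inf{ r ∈ [0,1) : ω̂(r) = ω̂(0) K^{-n} }`. -/
def rSeq (ω : ℝ → ℝ) (K : ℝ) (n : ℕ) : ℝ :=
  sInf {r | r ∈ Set.Ico (0:ℝ) 1 ∧ omegaHat ω r = omegaHat ω 0 * K ^ (-(n:ℝ))}

/-- `M_n = ⌊1/(1-r_n)⌋`. -/
def MSeq (ω : ℝ → ℝ) (K : ℝ) (n : ℕ) : ℕ := ⌊1 / (1 - rSeq ω K n)⌋₊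

/-- Weighted Hadamard product of a polynomial with an analytic function:
`z ↦ ∑_j c(j) P̂(j) ĝ(j) z^j`. -/
def hadamardPolyC (c : ℕ → ℂ) (P : Polynomial ℂ) (g : ℂ → ℂ) : ℂ → ℂ :=
  fun z => ∑ j ∈ Finset.range (P.natDegree + 1), c j * P.coeff j * taylorCoeff g j * z ^ j

/-- An admissible Banach space of analytic functions on the unit disc, given by a
carrier set and a norm function. -/
structure AdmissibleSpace where
  carrier : Set (ℂ → ℂ)
  nrm : (ℂ → ℂ) → ℝ
  mem_analytic : ∀ f ∈ carrier, DifferentiableOn ℂ f (Metric.ball 0 1)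
  zero_mem : (0 : ℂ → ℂ) ∈ carrier
  add_mem : ∀ f g : ℂ → ℂ, f ∈ carrier → g ∈ carrier → f + g ∈ carrier
  smul_mem : ∀ (c : ℂ) (f : ℂ → ℂ), f ∈ carrier → c • f ∈ carrier
  nrm_nonneg : ∀ f ∈ carrier, 0 ≤ nrm f
  nrm_eq_zero : ∀ f ∈ carrier, nrm f = 0 → ∀ z ∈ Metric.ball (0:ℂ) 1, f z = 0
  nrm_add : ∀ f g : ℂ → ℂ, f ∈ carrier → g ∈ carrier → nrm (f + g) ≤ nrm f + nrm g
  nrm_smul : ∀ (c : ℂ) (f : ℂ → ℂ), f ∈ carrier → nrm (c • f) = ‖c‖ * nrm f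
  complete : ∀ u : ℕ → (ℂ → ℂ), (∀ n, u n ∈ carrier) →
    (∀ ε : ℝ, 0 < ε → ∃ N : ℕ, ∀ m ≥ N, ∀ n ≥ N, nrm (u m - u n) < ε) →
    ∃ f ∈ carrier, Filter.Tendsto (fun n => nrm (u n - f)) Filter.atTop (nhds 0)
  norm_conv_implies_ucc : ∀ (u : ℕ → (ℂ → ℂ)) (f : ℂ → ℂ),
    (∀ n, u n ∈ carrier) → f ∈ carrier →
    Filter.Tendsto (fun n => nrm (u n - f)) Filter.atTop (nhds 0) →
    ∀ Kc : Set ℂ, Kc ⊆ Metric.ball 0 1 → IsCompact Kc →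
      TendstoUniformlyOn (fun n => u n) f Filter.atTop Kc
  ucc_implies_norm_conv : ∀ R : ℝ, 1 < R → ∀ (u : ℕ → (ℂ → ℂ)) (f : ℂ → ℂ),
    (∀ n, u n ∈ carrier ∧ DifferentiableOn ℂ (u n) (Metric.ball 0 R)) →
    DifferentiableOn ℂ f (Metric.ball 0 R) →
    (∀ Kc : Set ℂ, Kc ⊆ Metric.ball (0:ℂ) R → IsCompact Kc →
      TendstoUniformlyOn (fun n => u n) f Filter.atTop Kc) →
    f ∈ carrier ∧ Filter.Tendsto (fun n => nrm (u n - f)) Filter.atTop (nhds 0)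
  dilation_bound : ∃ C > (0:ℝ), ∀ f ∈ carrier, ∀ ζ : ℂ, ‖ζ‖ ≤ 1 →
    (fun z => f (ζ * z)) ∈ carrier ∧ nrm (fun z => f (ζ * z)) ≤ C * nrm f

/-- The operator `T_p = I^{ν_{1/p-2}}`. -/
def TpOp (p : ℝ) (g : ℂ → ℂ) : ℂ → ℂ :=
  fun z => ∑' k : ℕ,
    taylorCoeff g k * ((momentW (nuWeight (1 / p - 2)) (2 * (k:ℝ) + 1) : ℝ) : ℂ) * z ^ k

/-- Membership in the Bloch space. -/
def InBloch (g : ℂ → ℂ) : Prop :=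
  DifferentiableOn ℂ g (Metric.ball 0 1) ∧ BlochNormE g < ⊤

open Classical in
/-- The norm of the space `X_p = T_p(B)`, normed so that `T_p` is an isometry. -/
def XpNormE (p : ℝ) (h : ℂ → ℂ) : ℝ≥0∞ :=
  if H : ∃ g : ℂ → ℂ, InBloch g ∧ Set.EqOn h (TpOp p g) (Metric.ball 0 1)
  then BlochNormE H.choose else ⊤

/-- The polynomial `V_n ∗ g` where `V_n(z) = ∑_{j=2^{n-1}}^{2^{n+1}-1} ψ(j/2^{n-1}) z^j`
and `ψ(t) = Ψ(t/2) - Ψ(t)`. -/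
def VnStar (Ψ : ℝ → ℝ) (n : ℕ) (g : ℂ → ℂ) : ℂ → ℂ :=
  fun z => ∑ j ∈ Finset.Icc (2 ^ (n - 1) : ℕ) (2 ^ (n + 1) - 1 : ℕ),
    (((Ψ ((j:ℝ) / 2 ^ n) - Ψ ((j:ℝ) / 2 ^ (n - 1))) : ℝ) : ℂ) * taylorCoeff g j * z ^ j

/-- `D^ω(V_n ∗ g)`, where `D^ω h(z) = ∑ ĥ(k) z^k/(2ω_{2k+1})`. -/
def DVnStar (Ψ : ℝ → ℝ) (ω : ℝ → ℝ) (n : ℕ) (g : ℂ → ℂ) : ℂ → ℂ :=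
  fun z => ∑ j ∈ Finset.Icc (2 ^ (n - 1) : ℕ) (2 ^ (n + 1) - 1 : ℕ),
    (((Ψ ((j:ℝ) / 2 ^ n) - Ψ ((j:ℝ) / 2 ^ (n - 1))) : ℝ) : ℂ) * taylorCoeff g j * z ^ j /
      (2 * ((momentW ω (2 * (j:ℝ) + 1) : ℝ) : ℂ))

/-- `J_ω(t) = ∫_0^t ds/(ω̂(s)(1-s))`. -/
def Jomega (ω : ℝ → ℝ) (t : ℝ) : ℝ := ∫ s in (0:ℝ)..t, 1 / (omegaHat ω s * (1 - s))


/-- The moment `∫₀¹ r^m ω(r) dr` with a natural exponent. -/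
def natMoment (ω : ℝ → ℝ) (m : ℕ) : ℝ := ∫ r in (0:ℝ)..1, r ^ m * ω r

/-- The measure `ω(r) dr` on `(0,1)`. -/
def weightMeasure (ω : ℝ → ℝ) : Measure ℝ :=
  (volume.restrict (Ioo 0 1)).withDensity fun r => ENNReal.ofReal (ω r)

lemma ae_weightMeasure_mem_Ioo (ω : ℝ → ℝ) : ∀ᵐ r ∂weightMeasure ω, r ∈ Ioo (0:ℝ) 1 :=
  (withDensity_absolutelyContinuous _ _).ae_le (ae_restrict_mem measurableSet_Ioo)

lemma momentW_natCast (ω : ℝ → ℝ) (m : ℕ) : momentW ω m = natMoment ω m := by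
  simp only [momentW, natMoment, Real.rpow_natCast]

namespace IsRadialWeight

variable {ω : ℝ → ℝ}

lemma intervalIntegrable (hω : IsRadialWeight ω) : IntervalIntegrable ω volume 0 1 :=
  (intervalIntegrable_iff_integrableOn_Ico_of_le zero_le_one).2 hω.2

lemma intervalIntegrable_sub (hω : IsRadialWeight ω) {a b : ℝ} (ha : a ∈ Icc (0:ℝ) 1)
    (hb : b ∈ Icc (0:ℝ) 1) : IntervalIntegrable ω volume a b :=
  hω.intervalIntegrable.mono_set (by
    rw [uIcc_of_le zero_le_one]; exact uIcc_subset_Icc ha hb)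

lemma intervalIntegrable_pow_mul (hω : IsRadialWeight ω) (m : ℕ) {a b : ℝ}
    (ha : a ∈ Icc (0:ℝ) 1) (hb : b ∈ Icc (0:ℝ) 1) :
    IntervalIntegrable (fun r => r ^ m * ω r) volume a b :=
  (hω.intervalIntegrable_sub ha hb).continuousOn_mul (by fun_prop)

lemma omegaHat_anti (hω : IsRadialWeight ω) {a b : ℝ} (ha : 0 ≤ a) (hab : a ≤ b)
    (hb : b ≤ 1) : omegaHat ω b ≤ omegaHat ω a := by
  have h := intervalIntegral.integral_add_adjacent_intervals
    (hω.intervalIntegrable_sub ⟨ha, hab.trans hb⟩ ⟨ha.trans hab, hb⟩)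
    (hω.intervalIntegrable_sub ⟨ha.trans hab, hb⟩ ⟨zero_le_one, le_rfl⟩)
  have h0 : 0 ≤ ∫ s in a..b, ω s := by
    rw [intervalIntegral.integral_of_le hab, integral_Ioc_eq_integral_Ioo]
    exact setIntegral_nonneg measurableSet_Ioo
      fun x hx => hω.1 x ⟨ha.trans hx.1.le, hx.2.trans_le hb⟩
  unfold omegaHat
  linarith

lemma continuousOn_omegaHat (hω : IsRadialWeight ω) : ContinuousOn (omegaHat ω) (Icc 0 1) := by
  have := intervalIntegral.continuousOn_primitive_interval_left (μ := volume) (f := ω)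
    (a := 0) (b := 1) (by
      rw [uIcc_of_le zero_le_one, integrableOn_Icc_iff_integrableOn_Ico]; exact hω.2)
  rwa [uIcc_of_le zero_le_one] at this

lemma aemeasurable (hω : IsRadialWeight ω) : AEMeasurable ω (volume.restrict (Ioo 0 1)) :=
  (hω.2.mono_set Ioo_subset_Ico_self).aemeasurable

lemma lintegral_weightMeasure (hω : IsRadialWeight ω) {g : ℝ → ℝ}
    (hg : AEMeasurable g (volume.restrict (Ioo 0 1))) (hg0 : ∀ r ∈ Ioo (0:ℝ) 1, 0 ≤ g r) :
    ∫⁻ r, ENNReal.ofReal (g r) ∂weightMeasure ω =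
      ∫⁻ r in Ioo (0:ℝ) 1, ENNReal.ofReal (g r * ω r) := by
  rw [weightMeasure, lintegral_withDensity_eq_lintegral_mul₀ hω.aemeasurable.ennreal_ofReal
    hg.ennreal_ofReal]
  refine setLIntegral_congr_fun measurableSet_Ioo fun r hr => ?_
  simp only [Pi.mul_apply]
  rw [mul_comm, ENNReal.ofReal_mul (hg0 r hr)]

lemma lintegral_pow_weightMeasure (hω : IsRadialWeight ω) (m : ℕ) :
    ∫⁻ r, ENNReal.ofReal (r ^ m) ∂weightMeasure ω = ENNReal.ofReal (natMoment ω m) := by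
  rw [hω.lintegral_weightMeasure (by fun_prop) fun r hr => pow_nonneg hr.1.le m, natMoment,
    intervalIntegral.integral_of_le zero_le_one, integral_Ioc_eq_integral_Ioo,
    ofReal_integral_eq_lintegral_ofReal]
  · have := hω.intervalIntegrable_pow_mul m (a := 0) (b := 1) (by simp) (by simp)
    exact (intervalIntegrable_iff_integrableOn_Ioo_of_le zero_le_one).1 this
  · refine (ae_restrict_mem measurableSet_Ioo).mono fun r hr => ?_
    exact mul_nonneg (pow_nonneg hr.1.le m) (hω.1 r ⟨hr.1.le, hr.2⟩)

lemma weightMeasure_Ici (hω : IsRadialWeight ω) {t : ℝ} (ht : t ∈ Icc (0:ℝ) 1) :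
    weightMeasure ω (Ici t) = ENNReal.ofReal (omegaHat ω t) := by
  have h1 : (Ici t ∩ Ioo 0 1 : Set ℝ) =ᵐ[volume] Ioo t 1 := by
    have h2 : (Ici t ∩ Ioo 0 1 : Set ℝ) =ᵐ[volume] (Ioi t ∩ Ioo 0 1 : Set ℝ) :=
      Ioi_ae_eq_Ici.symm.inter (ae_eq_refl _)
    have h3 : (Ioi t ∩ Ioo 0 1 : Set ℝ) = Ioo t 1 := by
      ext x
      exact ⟨fun hx => ⟨hx.1, hx.2.2⟩, fun hx => ⟨hx.1, ht.1.trans_lt hx.1, hx.2⟩⟩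
    rwa [h3] at h2
  rw [weightMeasure, withDensity_apply _ measurableSet_Ici, Measure.restrict_restrict
    measurableSet_Ici, setLIntegral_congr h1, omegaHat, intervalIntegral.integral_of_le ht.2,
    integral_Ioc_eq_integral_Ioo, ofReal_integral_eq_lintegral_ofReal]
  · exact (intervalIntegrable_iff_integrableOn_Ioo_of_le ht.2).1
      (hω.intervalIntegrable_sub ht (by simp))
  · exact (ae_restrict_mem measurableSet_Ioo).mono fun r hr =>
      hω.1 r ⟨ht.1.trans hr.1.le, hr.2⟩

lemma weightMeasure_Ici_of_one_le {t : ℝ} (ht : 1 ≤ t) : weightMeasure ω (Ici t) = 0 := by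
  have : Ici t ∩ Ioo (0:ℝ) 1 = ∅ := by
    ext x; simp only [mem_inter_iff, mem_Ici, mem_Ioo, mem_empty_iff_false, iff_false]
    rintro ⟨h1, -, h2⟩; linarith
  rw [weightMeasure, withDensity_apply _ measurableSet_Ici, Measure.restrict_restrict
    measurableSet_Ici, this]
  simp

lemma natMoment_nonneg (hω : IsRadialWeight ω) (m : ℕ) : 0 ≤ natMoment ω m := by
  rw [natMoment, intervalIntegral.integral_of_le zero_le_one, integral_Ioc_eq_integral_Ioo]
  exact setIntegral_nonneg measurableSet_Ioo fun r hr =>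
    mul_nonneg (pow_nonneg hr.1.le m) (hω.1 r ⟨hr.1.le, hr.2⟩)

lemma natMoment_mono_of_le (hω : IsRadialWeight ω) {m n : ℕ} {c : ℝ}
    (h : ∀ r ∈ Ioo (0:ℝ) 1, r ^ m ≤ c * r ^ n) : natMoment ω m ≤ c * natMoment ω n := by
  rw [natMoment, natMoment, ← intervalIntegral.integral_const_mul]
  refine intervalIntegral.integral_mono_on_of_le_Ioo zero_le_one
    (hω.intervalIntegrable_pow_mul m (by simp) (by simp))
    ((hω.intervalIntegrable_pow_mul n (by simp) (by simp)).const_mul c) fun r hr => ?_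
  rw [← mul_assoc]
  exact mul_le_mul_of_nonneg_right (h r hr) (hω.1 r ⟨hr.1.le, hr.2⟩)

lemma natMoment_anti (hω : IsRadialWeight ω) {m n : ℕ} (h : n ≤ m) :
    natMoment ω m ≤ natMoment ω n := by
  simpa using hω.natMoment_mono_of_le (c := 1) fun r hr => by
    simpa using pow_le_pow_of_le_one hr.1.le hr.2.le h

lemma pow_mul_omegaHat_le_natMoment (hω : IsRadialWeight ω) (m : ℕ) {t : ℝ}
    (ht : t ∈ Icc (0:ℝ) 1) : t ^ m * omegaHat ω t ≤ natMoment ω m := by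
  have h01 : (0:ℝ) ∈ Icc (0:ℝ) 1 := by simp
  have h11 : (1:ℝ) ∈ Icc (0:ℝ) 1 := by simp
  have h := intervalIntegral.integral_add_adjacent_intervals
    (hω.intervalIntegrable_pow_mul m h01 ht) (hω.intervalIntegrable_pow_mul m ht h11)
  have h0 : 0 ≤ ∫ s in (0:ℝ)..t, s ^ m * ω s := by
    rw [intervalIntegral.integral_of_le ht.1, integral_Ioc_eq_integral_Ioo]
    exact setIntegral_nonneg measurableSet_Ioo
      fun x hx => mul_nonneg (pow_nonneg hx.1.le m) (hω.1 x ⟨hx.1.le, hx.2.trans_le ht.2⟩)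
  have h2 : t ^ m * omegaHat ω t ≤ ∫ s in t..1, s ^ m * ω s := by
    rw [omegaHat, ← intervalIntegral.integral_const_mul]
    refine intervalIntegral.integral_mono_on_of_le_Ioo ht.2
      ((hω.intervalIntegrable_sub ht h11).const_mul _)
      (hω.intervalIntegrable_pow_mul m ht h11) fun r hr => ?_
    exact mul_le_mul_of_nonneg_right (pow_le_pow_left₀ ht.1 hr.1.le m)
      (hω.1 r ⟨ht.1.trans hr.1.le, hr.2⟩)
  unfold natMoment
  linarith

/-- An upper doubling weight has doubling moments. -/
lemma natMoment_le_two_mul (hω : IsRadialWeight ω) {C : ℝ} (hC : 0 < C)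
    (hD : ∀ r ∈ Ico (0:ℝ) 1, omegaHat ω r ≤ C * omegaHat ω ((1 + r) / 2)) {m : ℕ} (hm : 0 < m) :
    natMoment ω m ≤ C * natMoment ω (2 * m) := by
  have hm' : (0:ℝ) < m := by exact_mod_cast hm
  have key : ENNReal.ofReal (natMoment ω m) ≤ ENNReal.ofReal C * ENNReal.ofReal
      (natMoment ω (2 * m)) := by
    calc ENNReal.ofReal (natMoment ω m)
        = ∫⁻ r, ENNReal.ofReal (r ^ (m:ℝ)) ∂weightMeasure ω := by
          rw [← hω.lintegral_pow_weightMeasure]; simp only [Real.rpow_natCast]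
      _ = ENNReal.ofReal m * ∫⁻ t in Ioi 0, weightMeasure ω {a : ℝ | t ≤ a} *
            ENNReal.ofReal (t ^ ((m:ℝ) - 1)) :=
          lintegral_rpow_eq_lintegral_meas_le_mul _ ((ae_weightMeasure_mem_Ioo ω).mono fun r hr => hr.1.le)
            aemeasurable_id hm'
      _ ≤ ENNReal.ofReal m * ∫⁻ t in Ioi 0, ENNReal.ofReal C *
            (weightMeasure ω {a : ℝ | t ≤ max (2 * a - 1) 0} *
            ENNReal.ofReal (t ^ ((m:ℝ) - 1))) := by
          gcongr _ * ?_
          refine setLIntegral_mono' measurableSet_Ioi fun t ht => ?_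
          rw [← mul_assoc]
          gcongr ?_ * _
          have ht0 : 0 < t := ht
          have hs : {a : ℝ | t ≤ max (2 * a - 1) 0} = Ici ((1 + t) / 2) := by
            ext a
            simp only [mem_ofPred_eq, le_max_iff, not_le.2 ht0, or_false, mem_Ici]
            constructor <;> intro h <;> linarith
          change weightMeasure ω (Ici t) ≤ _
          rw [hs]
          rcases lt_or_ge t 1 with h1 | h1
          · rw [hω.weightMeasure_Ici ⟨ht0.le, h1.le⟩,
              hω.weightMeasure_Ici ⟨by linarith, by linarith⟩, ← ENNReal.ofReal_mul hC.le]
            exact ENNReal.ofReal_le_ofReal (hD t ⟨ht0.le, h1⟩)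
          · rw [weightMeasure_Ici_of_one_le h1]; exact zero_le
      _ = ENNReal.ofReal C * ∫⁻ u, ENNReal.ofReal ((max (2 * u - 1) 0) ^ (m:ℝ))
            ∂weightMeasure ω := by
          rw [lintegral_const_mul' _ _ ENNReal.ofReal_ne_top,
            lintegral_rpow_eq_lintegral_meas_le_mul (f := fun u : ℝ => max (2 * u - 1) 0) _
              (ae_of_all _ fun r => le_max_right (2 * r - 1) 0) (by fun_prop) hm']
          ring
      _ ≤ ENNReal.ofReal C * ∫⁻ u, ENNReal.ofReal (u ^ (2 * m)) ∂weightMeasure ω := by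
          gcongr _ * ?_
          refine lintegral_mono_ae ((ae_weightMeasure_mem_Ioo ω).mono fun u hu => ENNReal.ofReal_le_ofReal ?_)
          rw [Real.rpow_natCast, pow_mul]
          exact pow_le_pow_left₀ (le_max_right _ _)
            (max_le (by nlinarith [sq_nonneg (u - 1)]) (sq_nonneg u)) m
      _ = _ := by rw [hω.lintegral_pow_weightMeasure]
  rw [← ENNReal.ofReal_mul hC.le] at key
  exact (ENNReal.ofReal_le_ofReal_iff (mul_nonneg hC.le (hω.natMoment_nonneg _))).1 key

end IsRadialWeight

/-- The power series `∑ cₙ e^{inθ}` on the unit circle. -/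
def circleSeries (c : ℕ → ℂ) (θ : ℝ) : ℂ := ∑' n, c n * Complex.exp (θ * Complex.I) ^ n

section CircleSeries

variable {c d : ℕ → ℂ}

lemma norm_term_circleSeries (c : ℕ → ℂ) (θ : ℝ) (n : ℕ) :
    ‖c n * Complex.exp (θ * Complex.I) ^ n‖ = ‖c n‖ := by
  rw [norm_mul, norm_pow, Complex.norm_exp_ofReal_mul_I, one_pow, mul_one]

lemma summable_circleSeries (hc : Summable fun n => ‖c n‖) (θ : ℝ) :
    Summable fun n => c n * Complex.exp (θ * Complex.I) ^ n :=
  Summable.of_norm (by simpa only [norm_term_circleSeries] using hc)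

lemma continuous_circleSeries (hc : Summable fun n => ‖c n‖) : Continuous (circleSeries c) :=
  continuous_tsum (fun n => by fun_prop) hc fun n θ => (norm_term_circleSeries c θ n).le

lemma norm_circleSeries_le (hc : Summable fun n => ‖c n‖) (θ : ℝ) :
    ‖circleSeries c θ‖ ≤ ∑' n, ‖c n‖ := by
  refine (norm_tsum_le_tsum_norm ?_).trans ?_ <;> simp only [norm_term_circleSeries]
  exacts [hc, le_rfl]

lemma circleSeries_sub (hc : Summable fun n => ‖c n‖) (hd : Summable fun n => ‖d n‖) (θ : ℝ) :
    circleSeries (fun n => c n - d n) θ = circleSeries c θ - circleSeries d θ := by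
  simp only [circleSeries, sub_mul]
  exact (summable_circleSeries hc θ).tsum_sub (summable_circleSeries hd θ)

lemma integral_exp_pow_mul_conj_exp_pow (n m : ℕ) :
    ∫ θ in (0:ℝ)..2 * Real.pi, Complex.exp (θ * Complex.I) ^ n *
      (starRingEnd ℂ) (Complex.exp (θ * Complex.I)) ^ m = if n = m then 2 * Real.pi else 0 := by
  have h : ∀ θ : ℝ, Complex.exp (θ * Complex.I) ^ n *
      (starRingEnd ℂ) (Complex.exp (θ * Complex.I)) ^ m =
      Complex.exp (((n:ℂ) - m) * Complex.I * θ) := by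
    intro θ
    rw [← Complex.exp_conj, ← Complex.exp_nat_mul, ← Complex.exp_nat_mul, ← Complex.exp_add]
    simp only [map_mul, Complex.conj_ofReal, Complex.conj_I]
    ring_nf
  simp only [h]
  split_ifs with hnm
  · simp [hnm]
  · have h0 : ((n:ℂ) - m) * Complex.I ≠ 0 :=
      mul_ne_zero (sub_ne_zero.2 (by exact_mod_cast hnm)) Complex.I_ne_zero
    rw [integral_exp_mul_complex h0]
    have : Complex.exp (((n:ℂ) - m) * Complex.I * ((2 * Real.pi : ℝ) : ℂ)) = 1 :=
      Complex.exp_eq_one_iff.2 ⟨(n:ℤ) - m, by push_cast; ring⟩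
    rw [this]
    simp

lemma integral_exp_pow_mul_conj_circleSeries (hc : Summable fun n => ‖c n‖) (n : ℕ) :
    ∫ θ in (0:ℝ)..2 * Real.pi, Complex.exp (θ * Complex.I) ^ n *
      (starRingEnd ℂ) (circleSeries c θ) = 2 * Real.pi * (starRingEnd ℂ) (c n) := by
  have h := intervalIntegral.hasSum_integral_of_dominated_convergence (μ := volume)
    (a := 0) (b := 2 * Real.pi)
    (F := fun (m : ℕ) (θ : ℝ) => Complex.exp (θ * Complex.I) ^ n *
      (starRingEnd ℂ) (c m * Complex.exp (θ * Complex.I) ^ m))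
    (f := fun θ => Complex.exp (θ * Complex.I) ^ n * (starRingEnd ℂ) (circleSeries c θ))
    (fun m _ => ‖c m‖)
    (fun m => Continuous.aestronglyMeasurable (by fun_prop))
    (fun m => ae_of_all _ fun θ _ => by
      rw [norm_mul, RCLike.norm_conj, norm_term_circleSeries, norm_pow,
        Complex.norm_exp_ofReal_mul_I, one_pow, one_mul])
    (ae_of_all _ fun θ _ => hc) (by simp)
    (ae_of_all _ fun θ _ => by
      have := (summable_circleSeries hc θ).hasSum
      exact ((Complex.hasSum_conj'.2 this)).mul_left _)
  have h2 : ∀ m, (∫ θ in (0:ℝ)..2 * Real.pi, Complex.exp (θ * Complex.I) ^ n *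
      (starRingEnd ℂ) (c m * Complex.exp (θ * Complex.I) ^ m)) =
      if m = n then 2 * Real.pi * (starRingEnd ℂ) (c n) else 0 := by
    intro m
    have : ∀ θ : ℝ, Complex.exp (θ * Complex.I) ^ n *
        (starRingEnd ℂ) (c m * Complex.exp (θ * Complex.I) ^ m) = (starRingEnd ℂ) (c m) *
        (Complex.exp (θ * Complex.I) ^ n * (starRingEnd ℂ) (Complex.exp (θ * Complex.I)) ^ m) := by
      intro θ; rw [map_mul, map_pow]; ring
    simp only [this]
    rw [intervalIntegral.integral_const_mul, integral_exp_pow_mul_conj_exp_pow]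
    split_ifs with h1 h2 h2
    · subst h1; push_cast; ring
    · exact absurd h1.symm h2
    · exact absurd h2.symm h1
    · simp
  simp only [h2] at h
  exact h.unique (hasSum_ite_eq n _)

/-- Parseval's identity for absolutely convergent power series on the circle. -/
lemma integral_norm_circleSeries_sq (hc : Summable fun n => ‖c n‖) :
    HasSum (fun n => 2 * Real.pi * ‖c n‖ ^ 2)
      (∫ θ in (0:ℝ)..2 * Real.pi, ‖circleSeries c θ‖ ^ 2) := by
  have hcont := continuous_circleSeries hc
  have h := intervalIntegral.hasSum_integral_of_dominated_convergence (μ := volume)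
    (a := 0) (b := 2 * Real.pi)
    (F := fun (m : ℕ) (θ : ℝ) => (c m * Complex.exp (θ * Complex.I) ^ m) *
      (starRingEnd ℂ) (circleSeries c θ))
    (f := fun θ => circleSeries c θ * (starRingEnd ℂ) (circleSeries c θ))
    (fun m _ => ‖c m‖ * ∑' n, ‖c n‖)
    (fun m => Continuous.aestronglyMeasurable (by fun_prop))
    (fun m => ae_of_all _ fun θ _ => by
      rw [norm_mul, RCLike.norm_conj, norm_term_circleSeries]
      gcongr
      exact norm_circleSeries_le hc θ)
    (ae_of_all _ fun θ _ => hc.mul_right _) (by simp)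
    (ae_of_all _ fun θ _ => ((summable_circleSeries hc θ).hasSum).mul_right _)
  have h2 : ∀ m, (∫ θ in (0:ℝ)..2 * Real.pi, (c m * Complex.exp (θ * Complex.I) ^ m) *
      (starRingEnd ℂ) (circleSeries c θ)) = ((2 * Real.pi * ‖c m‖ ^ 2 : ℝ) : ℂ) := by
    intro m
    simp only [mul_assoc]
    rw [intervalIntegral.integral_const_mul, integral_exp_pow_mul_conj_circleSeries hc]
    rw [mul_left_comm, Complex.mul_conj']
    push_cast; ring
  have h3 : (∫ θ in (0:ℝ)..2 * Real.pi, circleSeries c θ * (starRingEnd ℂ) (circleSeries c θ)) =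
      ((∫ θ in (0:ℝ)..2 * Real.pi, ‖circleSeries c θ‖ ^ 2 : ℝ) : ℂ) := by
    rw [← intervalIntegral.integral_ofReal]
    refine intervalIntegral.integral_congr fun θ _ => ?_
    simp only [Complex.mul_conj']
    push_cast; ring
  simp only [h2] at h
  rw [h3] at h
  exact_mod_cast h

/-- If multiplication by `1 - ρz` produces square-summable coefficients, then the `L¹` norm of the
series is controlled. The parameter `l` is to be optimized. -/
lemma integral_norm_circleSeries_le (hc : Summable fun n => ‖c n‖) (h0 : c 0 = 0) {ρ : ℝ}
    (hρ : ρ ∈ Ico (0:ℝ) 1) {l S : ℝ} (hl : 0 < l)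
    (hS : HasSum (fun n => ‖c (n + 1) - ρ * c n‖ ^ 2) S) :
    ∫ θ in (0:ℝ)..2 * Real.pi, ‖circleSeries c θ‖ ≤
      Real.pi * (l * (1 - ρ)⁻¹ + S / l) := by
  set e : ℕ → ℂ := fun n => c (n + 1) - ρ * c n with he
  have hc1 : Summable fun n => ‖c (n + 1)‖ := (summable_nat_add_iff 1).2 hc
  have hcρ : Summable fun n => ‖(ρ:ℂ) * c n‖ := by
    simpa only [norm_mul] using hc.mul_left ‖(ρ:ℂ)‖
  have hes : Summable fun n => ‖e n‖ :=
    (hc1.add hcρ).of_nonneg_of_le (fun n => norm_nonneg _) fun n => norm_sub_le _ _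
  have hnρ : ‖(ρ:ℂ)‖ = ρ := by simpa using hρ.1
  have hps : Summable fun n => ‖(ρ:ℂ) ^ n‖ := by
    simpa only [norm_pow, hnρ] using summable_geometric_of_lt_one hρ.1 hρ.2
  have hnorm : ∀ θ, ‖circleSeries c θ‖ =
      ‖circleSeries (fun n => (ρ:ℂ) ^ n) θ‖ * ‖circleSeries e θ‖ := by
    intro θ
    set z := Complex.exp (θ * Complex.I) with hz
    have hz1 : ‖z‖ = 1 := Complex.norm_exp_ofReal_mul_I θ
    have hρz : ‖(ρ:ℂ) * z‖ < 1 := by rw [norm_mul, hz1, hnρ, mul_one]; exact hρ.2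
    have hP : circleSeries (fun n => (ρ:ℂ) ^ n) θ = (1 - ρ * z)⁻¹ := by
      simp only [circleSeries, ← mul_pow]
      exact tsum_geometric_of_norm_lt_one hρz
    have hQ : z * circleSeries e θ = (1 - ρ * z) * circleSeries c θ := by
      rw [he, circleSeries_sub hc1 hcρ]
      have h1 : z * circleSeries (fun n => c (n + 1)) θ = circleSeries c θ := by
        rw [circleSeries, circleSeries, (summable_circleSeries hc θ).tsum_eq_zero_add, h0,
          zero_mul, zero_add, ← tsum_mul_left]
        refine tsum_congr fun n => ?_
        rw [pow_succ]; ring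
      have h2 : circleSeries (fun n => (ρ:ℂ) * c n) θ = ρ * circleSeries c θ := by
        simp only [circleSeries, mul_assoc, tsum_mul_left]
      rw [mul_sub, h1, h2]; ring
    have hne : (1 - (ρ:ℂ) * z) ≠ 0 := by
      intro h
      rw [sub_eq_zero] at h
      rw [← h] at hρz
      simp at hρz
    rw [hP, norm_inv, ← one_mul ‖circleSeries e θ‖, ← hz1, ← norm_mul z, hQ, norm_mul]
    field_simp [norm_ne_zero_iff.2 hne]
  have hP := integral_norm_circleSeries_sq hps
  have hQ := (integral_norm_circleSeries_sq hes).unique (hS.mul_left (2 * Real.pi))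
  have hPle : (∫ θ in (0:ℝ)..2 * Real.pi, ‖circleSeries (fun n => (ρ:ℂ) ^ n) θ‖ ^ 2) ≤
      2 * Real.pi * (1 - ρ)⁻¹ := by
    refine hasSum_le (fun n => ?_) hP ((hasSum_geometric_of_lt_one hρ.1 hρ.2).mul_left _)
    rw [norm_pow, hnρ, ← pow_mul]
    have := pow_le_pow_of_le_one hρ.1 hρ.2.le (show n ≤ n * 2 by omega)
    gcongr
  have hcP := continuous_circleSeries hps
  have hcQ := continuous_circleSeries hes
  calc ∫ θ in (0:ℝ)..2 * Real.pi, ‖circleSeries c θ‖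
      ≤ ∫ θ in (0:ℝ)..2 * Real.pi, (l / 2 * ‖circleSeries (fun n => (ρ:ℂ) ^ n) θ‖ ^ 2 +
          1 / (2 * l) * ‖circleSeries e θ‖ ^ 2) := by
        refine intervalIntegral.integral_mono_on Real.two_pi_pos.le
          (Continuous.intervalIntegrable (continuous_circleSeries hc).norm _ _)
          (Continuous.intervalIntegrable (by fun_prop) _ _) fun θ _ => ?_
        rw [hnorm θ]
        have := sq_nonneg (l * ‖circleSeries (fun n => (ρ:ℂ) ^ n) θ‖ - ‖circleSeries e θ‖)
        have h2 : 0 ≤ 1 / (2 * l) *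
          (l * ‖circleSeries (fun n => (ρ:ℂ) ^ n) θ‖ - ‖circleSeries e θ‖) ^ 2 := by positivity
        have h3 : 1 / (2 * l) * (l * ‖circleSeries (fun n => (ρ:ℂ) ^ n) θ‖ -
            ‖circleSeries e θ‖) ^ 2 = l / 2 * ‖circleSeries (fun n => (ρ:ℂ) ^ n) θ‖ ^ 2 +
          1 / (2 * l) * ‖circleSeries e θ‖ ^ 2 -
          ‖circleSeries (fun n => (ρ:ℂ) ^ n) θ‖ * ‖circleSeries e θ‖ := by
          field_simp; ring
        linarith
    _ = l / 2 * (∫ θ in (0:ℝ)..2 * Real.pi, ‖circleSeries (fun n => (ρ:ℂ) ^ n) θ‖ ^ 2) +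
          1 / (2 * l) * (2 * Real.pi * S) := by
        rw [intervalIntegral.integral_add (Continuous.intervalIntegrable (by fun_prop) _ _)
          (Continuous.intervalIntegrable (by fun_prop) _ _),
          intervalIntegral.integral_const_mul, intervalIntegral.integral_const_mul, hQ]
    _ ≤ l / 2 * (2 * Real.pi * (1 - ρ)⁻¹) + 1 / (2 * l) * (2 * Real.pi * S) := by gcongr
    _ = _ := by field_simp

end CircleSeries

/-- The coefficients of the Bergman kernel. -/
def kernelCoeff (ω : ℝ → ℝ) (n : ℕ) : ℝ := (2 * natMoment ω (2 * n + 1))⁻¹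

/-- The integral `∫₀^{2π} |∑ ρⁿ e^{inθ} / (2 ω_{2n+1})| dθ`. -/
def kernelMean (ω : ℝ → ℝ) (ρ : ℝ) : ℝ :=
  ∫ θ in (0:ℝ)..2 * Real.pi, ‖circleSeries (fun n => ((kernelCoeff ω n * ρ ^ n : ℝ) : ℂ)) θ‖

lemma pow_succ_sub_pow_succ_le {x y : ℝ} (hx : 0 ≤ x) (hxy : x ≤ y) (n : ℕ) :
    y ^ (n + 1) - x ^ (n + 1) ≤ (n + 1) * y ^ n * (y - x) := by
  induction n with
  | zero => simp
  | succ n ih =>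
    have h1 := mul_le_mul_of_nonneg_left ih (hx.trans hxy)
    have h2 := mul_le_mul_of_nonneg_right (pow_le_pow_left₀ hx hxy (n + 1)) (sub_nonneg.2 hxy)
    push_cast
    rw [pow_succ y (n + 1), pow_succ x (n + 1)]
    have h3 : y * ((n + 1) * y ^ n * (y - x)) = (n + 1) * y ^ (n + 1) * (y - x) := by ring
    linarith

lemma pow_mul_one_sub_sq_le {r : ℝ} (h0 : 0 ≤ r) (h1 : r ≤ 1) (n : ℕ) :
    r ^ (2 * n + 1) - r ^ (2 * n + 3) ≤ 2 / (n + 1) * r ^ (n + 1) := by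
  have h := pow_succ_sub_pow_succ_le h0 h1 n
  have hb : (n + 1) * r ^ n * (1 - r) ≤ 1 := by
    clear h
    have hs : (∑ i ∈ Finset.range (n + 1), r ^ i) * (1 - r) = 1 - r ^ (n + 1) := by
      have := geom_sum_mul r (n + 1)
      linarith
    have hle : (n + 1) * r ^ n ≤ ∑ i ∈ Finset.range (n + 1), r ^ i := by
      have := Finset.card_nsmul_le_sum (Finset.range (n + 1)) (fun i => r ^ i) (r ^ n)
        fun i hi => pow_le_pow_of_le_one h0 h1 (by have := Finset.mem_range.1 hi; omega)
      simpa using this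
    have := mul_le_mul_of_nonneg_right hle (sub_nonneg.2 h1)
    have := pow_nonneg h0 (n + 1)
    linarith
  have hn : (0:ℝ) < n + 1 := by positivity
  have hfac : r ^ (2 * n + 1) - r ^ (2 * n + 3) =
      ((n + 1) * r ^ n * (1 - r)) * ((1 + r) * (r ^ (n + 1) / (n + 1))) := by
    field_simp
    ring
  have hq : 0 ≤ r ^ (n + 1) / ((n:ℝ) + 1) := by positivity
  rw [hfac]
  calc _ ≤ 1 * ((1 + r) * (r ^ (n + 1) / (n + 1))) := by gcongr
    _ ≤ 1 * (2 * (r ^ (n + 1) / (n + 1))) := by gcongr; linarith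
    _ = _ := by ring

section KernelMean

variable {ω : ℝ → ℝ} {C : ℝ}

lemma natMoment_pos (hω : IsRadialWeight ω) (hpos : ∀ r ∈ Ico (0:ℝ) 1, 0 < omegaHat ω r)
    (m : ℕ) : 0 < natMoment ω m :=
  (mul_pos (by positivity) (hpos (1 / 2) (by norm_num))).trans_le
    (hω.pow_mul_omegaHat_le_natMoment m (by norm_num))

lemma kernelCoeff_pos (hω : IsRadialWeight ω) (hpos : ∀ r ∈ Ico (0:ℝ) 1, 0 < omegaHat ω r)
    (n : ℕ) : 0 < kernelCoeff ω n :=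
  inv_pos.2 (mul_pos two_pos (natMoment_pos hω hpos _))

lemma kernelCoeff_mono (hω : IsRadialWeight ω) (hpos : ∀ r ∈ Ico (0:ℝ) 1, 0 < omegaHat ω r)
    (n : ℕ) : kernelCoeff ω n ≤ kernelCoeff ω (n + 1) := by
  have := natMoment_pos hω hpos (2 * (n + 1) + 1)
  have h2 := hω.natMoment_anti (show 2 * n + 1 ≤ 2 * (n + 1) + 1 by omega)
  unfold kernelCoeff
  gcongr

lemma kernelCoeff_succ_sub_le (hω : IsRadialWeight ω)
    (hpos : ∀ r ∈ Ico (0:ℝ) 1, 0 < omegaHat ω r) (hC : 0 < C)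
    (hD : ∀ r ∈ Ico (0:ℝ) 1, omegaHat ω r ≤ C * omegaHat ω ((1 + r) / 2)) (n : ℕ) :
    kernelCoeff ω (n + 1) - kernelCoeff ω n ≤ 2 * C ^ 2 / (n + 1) * kernelCoeff ω n := by
  have p1 := natMoment_pos hω hpos (2 * n + 1)
  have p3 := natMoment_pos hω hpos (2 * (n + 1) + 1)
  have hdiff : natMoment ω (2 * n + 1) - natMoment ω (2 * (n + 1) + 1) ≤
      2 / (n + 1) * natMoment ω (n + 1) := by
    have hi := fun m => hω.intervalIntegrable_pow_mul m (a := 0) (b := 1) (by simp) (by simp)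
    simp only [natMoment]
    rw [← intervalIntegral.integral_sub (hi _) (hi _), ← intervalIntegral.integral_const_mul]
    refine intervalIntegral.integral_mono_on_of_le_Ioo zero_le_one
      ((hi _).sub (hi _)) ((hi _).const_mul _) fun r hr => ?_
    rw [← sub_mul, ← mul_assoc]
    exact mul_le_mul_of_nonneg_right (pow_mul_one_sub_sq_le hr.1.le hr.2.le n)
      (hω.1 r ⟨hr.1.le, hr.2⟩)
  have hdoub : natMoment ω (n + 1) ≤ C ^ 2 * natMoment ω (2 * (n + 1) + 1) := by
    have h1 := hω.natMoment_le_two_mul hC hD (m := n + 1) (by omega)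
    have h2 := hω.natMoment_le_two_mul hC hD (m := 2 * (n + 1)) (by omega)
    have h3 := hω.natMoment_anti (show 2 * (n + 1) + 1 ≤ 2 * (2 * (n + 1)) by omega)
    calc natMoment ω (n + 1) ≤ C * natMoment ω (2 * (n + 1)) := h1
      _ ≤ C * (C * natMoment ω (2 * (2 * (n + 1)))) := by gcongr
      _ ≤ C * (C * natMoment ω (2 * (n + 1) + 1)) := by gcongr
      _ = _ := by ring
  have hkey : natMoment ω (2 * n + 1) - natMoment ω (2 * (n + 1) + 1) ≤
      2 * C ^ 2 / (n + 1) * natMoment ω (2 * (n + 1) + 1) := by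
    refine hdiff.trans ?_
    calc _ ≤ 2 / ((n:ℝ) + 1) * (C ^ 2 * natMoment ω (2 * (n + 1) + 1)) := by gcongr
      _ = _ := by ring
  have heq : kernelCoeff ω (n + 1) - kernelCoeff ω n = kernelCoeff ω n *
      ((natMoment ω (2 * n + 1) - natMoment ω (2 * (n + 1) + 1)) /
        natMoment ω (2 * (n + 1) + 1)) := by
    unfold kernelCoeff
    field_simp
  rw [heq, mul_comm]
  exact mul_le_mul_of_nonneg_right ((div_le_iff₀ p3).2 hkey) (kernelCoeff_pos hω hpos n).le

lemma kernelCoeff_mul_pow_le (hω : IsRadialWeight ω)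
    (hpos : ∀ r ∈ Ico (0:ℝ) 1, 0 < omegaHat ω r) (hC : 0 < C)
    (hD : ∀ r ∈ Ico (0:ℝ) 1, omegaHat ω r ≤ C * omegaHat ω ((1 + r) / 2))
    {ρ : ℝ} (hρ : ρ ∈ Ico (0:ℝ) 1) (n : ℕ) :
    kernelCoeff ω n * ρ ^ n ≤ C ^ 2 / omegaHat ω ρ * (((3 + ρ) / 4) ^ 2) ^ n := by
  set t := (3 + ρ) / 4 with ht
  have ht0 : 3 / 4 ≤ t := by have := hρ.1; linarith
  have htp : 0 < t := by linarith
  have ht1 : t < 1 := by have := hρ.2; linarith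
  have hρt : ρ ≤ t ^ 4 := by
    have := one_add_mul_le_pow (show (-2:ℝ) ≤ -((1 - ρ) / 4) by linarith [hρ.1]) 4
    rw [ht]
    have e1 : (3 + ρ) / 4 = 1 + -((1 - ρ) / 4) := by ring
    rw [e1]
    push_cast at this
    linarith
  have hhat : omegaHat ω ρ ≤ C ^ 2 * omegaHat ω t := by
    have h1 := hD ρ hρ
    have h2 := hD ((1 + ρ) / 2) ⟨by linarith [hρ.1], by linarith [hρ.2]⟩
    have h3 : (1 + (1 + ρ) / 2) / 2 = t := by rw [ht]; ring
    rw [h3] at h2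
    nlinarith
  have hmom := hω.pow_mul_omegaHat_le_natMoment (2 * n + 1) (t := t) ⟨htp.le, ht1.le⟩
  have hpt := hpos t ⟨htp.le, ht1⟩
  have hpρ := hpos ρ hρ
  have hlow : t ^ (2 * n) * (omegaHat ω ρ / C ^ 2) ≤ 2 * natMoment ω (2 * n + 1) := by
    have h1 : omegaHat ω ρ / C ^ 2 ≤ omegaHat ω t := by
      rw [div_le_iff₀ (by positivity)]; linarith
    calc t ^ (2 * n) * (omegaHat ω ρ / C ^ 2) ≤ t ^ (2 * n) * ((2 * t) * omegaHat ω t) := by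
          gcongr
          nlinarith
      _ = 2 * (t ^ (2 * n + 1) * omegaHat ω t) := by ring
      _ ≤ _ := by gcongr
  calc kernelCoeff ω n * ρ ^ n
      ≤ (t ^ (2 * n) * (omegaHat ω ρ / C ^ 2))⁻¹ * (t ^ 4) ^ n := by
        unfold kernelCoeff
        have := hρ.1
        gcongr
    _ = _ := by
        rw [← pow_mul, ← pow_mul, show 4 * n = 2 * n + 2 * n by ring, pow_add]
        field_simp

lemma inv_one_sub_sq_le {ρ : ℝ} (hρ : ρ ∈ Ico (0:ℝ) 1) (k : ℕ) (hk : k ≠ 0) :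
    (1 - ((3 + ρ) / 4) ^ k)⁻¹ ≤ 4 / (1 - ρ) := by
  have h0 := hρ.1
  have h1 := hρ.2
  have h2 : ((3 + ρ) / 4) ^ k ≤ (3 + ρ) / 4 :=
    pow_le_of_le_one (by linarith) (by linarith) hk
  calc (1 - ((3 + ρ) / 4) ^ k)⁻¹ ≤ (1 - (3 + ρ) / 4)⁻¹ :=
        inv_anti₀ (by linarith) (by linarith)
    _ = 4 / (1 - ρ) := by
        have : 1 - ρ ≠ 0 := by linarith
        rw [show 1 - (3 + ρ) / 4 = (1 - ρ) / 4 by ring, inv_div]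

lemma summable_kernelCoeff_mul_pow (hω : IsRadialWeight ω)
    (hpos : ∀ r ∈ Ico (0:ℝ) 1, 0 < omegaHat ω r) (hC : 0 < C)
    (hD : ∀ r ∈ Ico (0:ℝ) 1, omegaHat ω r ≤ C * omegaHat ω ((1 + r) / 2))
    {ρ : ℝ} (hρ : ρ ∈ Ico (0:ℝ) 1) :
    Summable fun n => ‖((kernelCoeff ω n * ρ ^ n : ℝ) : ℂ)‖ := by
  have h0 := hρ.1
  have h1 := hρ.2
  refine Summable.of_nonneg_of_le (fun n => norm_nonneg _) (fun n => ?_)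
    ((summable_geometric_of_lt_one (r := ((3 + ρ) / 4) ^ 2) (by positivity)
      (pow_lt_one₀ (by linarith) (by linarith) two_ne_zero)).mul_left (C ^ 2 / omegaHat ω ρ))
  rw [Complex.norm_real, Real.norm_of_nonneg
    (mul_nonneg (kernelCoeff_pos hω hpos n).le (pow_nonneg h0 n))]
  exact kernelCoeff_mul_pow_le hω hpos hC hD hρ n

lemma kernelMean_le_div_one_sub (hω : IsRadialWeight ω)
    (hpos : ∀ r ∈ Ico (0:ℝ) 1, 0 < omegaHat ω r) (hC : 0 < C)
    (hD : ∀ r ∈ Ico (0:ℝ) 1, omegaHat ω r ≤ C * omegaHat ω ((1 + r) / 2))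
    {ρ : ℝ} (hρ : ρ ∈ Ico (0:ℝ) 1) :
    kernelMean ω ρ ≤ 2 * Real.pi * (C ^ 2 / omegaHat ω ρ * (4 / (1 - ρ))) := by
  have h0 := hρ.1
  have h1 := hρ.2
  have hs := summable_kernelCoeff_mul_pow hω hpos hC hD hρ
  have hA : 0 ≤ C ^ 2 / omegaHat ω ρ := div_nonneg (by positivity) (hpos ρ hρ).le
  have hgeo := (hasSum_geometric_of_lt_one (r := ((3 + ρ) / 4) ^ 2) (by positivity)
      (pow_lt_one₀ (by linarith) (by linarith) two_ne_zero)).mul_left (C ^ 2 / omegaHat ω ρ)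
  have hle : ∑' n, ‖((kernelCoeff ω n * ρ ^ n : ℝ) : ℂ)‖ ≤
      C ^ 2 / omegaHat ω ρ * (4 / (1 - ρ)) := by
    refine (hasSum_le (fun n => ?_) hs.hasSum hgeo).trans
      (mul_le_mul_of_nonneg_left (inv_one_sub_sq_le hρ 2 two_ne_zero) hA)
    rw [Complex.norm_real, Real.norm_of_nonneg
      (mul_nonneg (kernelCoeff_pos hω hpos n).le (pow_nonneg h0 n))]
    exact kernelCoeff_mul_pow_le hω hpos hC hD hρ n
  calc kernelMean ω ρ ≤ ∫ _ in (0:ℝ)..2 * Real.pi, C ^ 2 / omegaHat ω ρ * (4 / (1 - ρ)) :=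
        intervalIntegral.integral_mono_on Real.two_pi_pos.le
          ((continuous_circleSeries hs).norm.intervalIntegrable _ _) (by simp)
          fun θ _ => (norm_circleSeries_le hs θ).trans hle
    _ = _ := by rw [intervalIntegral.integral_const, sub_zero, smul_eq_mul]

lemma kernelMean_le_add (hω : IsRadialWeight ω)
    (hpos : ∀ r ∈ Ico (0:ℝ) 1, 0 < omegaHat ω r) (hC : 0 < C)
    (hD : ∀ r ∈ Ico (0:ℝ) 1, omegaHat ω r ≤ C * omegaHat ω ((1 + r) / 2))
    {K : ℝ} (hK : 1 < K) {ρ σ : ℝ} (hρ : ρ < 1) (hσ : 0 ≤ σ) (hσρ : 1 - σ = K * (1 - ρ)) :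
    kernelMean ω ρ ≤ kernelMean ω σ +
      4 * Real.pi * ((2 * C ^ 2 + 1) * (K - 1) * (C ^ 2 / omegaHat ω ρ)) := by
  have hρ1 : 0 < 1 - ρ := by linarith
  have hK1 : 0 < K - 1 := by linarith
  have hdiff : ρ - σ = (K - 1) * (1 - ρ) := by linarith
  have hle : σ ≤ ρ := by nlinarith
  have hρm : ρ ∈ Ico (0:ℝ) 1 := ⟨hσ.trans hle, hρ⟩
  have hσm : σ ∈ Ico (0:ℝ) 1 := ⟨hσ, hle.trans_lt hρ⟩
  have hρ0 := hρm.1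
  set A := C ^ 2 / omegaHat ω ρ with hAdef
  have hA : 0 < A := div_pos (by positivity) (hpos ρ hρm)
  set B := (2 * C ^ 2 + 1) * (K - 1) with hBdef
  have hB : 0 < B := by positivity
  have hsρ := summable_kernelCoeff_mul_pow hω hpos hC hD hρm
  have hsσ := summable_kernelCoeff_mul_pow hω hpos hC hD hσm
  set d : ℕ → ℂ := fun n => ((kernelCoeff ω n * ρ ^ n : ℝ) : ℂ) -
    ((kernelCoeff ω n * σ ^ n : ℝ) : ℂ) with hd
  have hsd : Summable fun n => ‖d n‖ :=
    (hsρ.add hsσ).of_nonneg_of_le (fun n => norm_nonneg _) fun n => norm_sub_le _ _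
  have hd0 : d 0 = 0 := by simp [hd]
  have hterm : ∀ n, ‖d (n + 1) - ρ * d n‖ ≤ B * (1 - ρ) * (A * (((3 + ρ) / 4) ^ 2) ^ n) := by
    intro n
    have hid : d (n + 1) - ρ * d n = (((kernelCoeff ω (n + 1) - kernelCoeff ω n) *
        (ρ ^ (n + 1) - σ ^ (n + 1)) + kernelCoeff ω n * ((ρ - σ) * σ ^ n) : ℝ) : ℂ) := by
      simp only [hd]; push_cast; ring
    have hc := kernelCoeff_pos hω hpos n
    have hm := sub_nonneg.2 (kernelCoeff_mono hω hpos n)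
    have hp : 0 ≤ ρ ^ (n + 1) - σ ^ (n + 1) := sub_nonneg.2 (pow_le_pow_left₀ hσ hle _)
    have hρσ : 0 ≤ ρ - σ := sub_nonneg.2 hle
    rw [hid, Complex.norm_real, Real.norm_of_nonneg (by positivity)]
    calc _ ≤ (2 * C ^ 2 / (n + 1) * kernelCoeff ω n) * ((n + 1) * ρ ^ n * (ρ - σ)) +
          kernelCoeff ω n * ((ρ - σ) * ρ ^ n) := by
          gcongr
          · exact kernelCoeff_succ_sub_le hω hpos hC hD n
          · exact pow_succ_sub_pow_succ_le hσ hle n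
      _ = B * (1 - ρ) * (kernelCoeff ω n * ρ ^ n) := by
          rw [hdiff, hBdef]
          have : (n:ℝ) + 1 ≠ 0 := by positivity
          field_simp
      _ ≤ _ := by
          exact mul_le_mul_of_nonneg_left (kernelCoeff_mul_pow_le hω hpos hC hD hρm n)
            (by positivity)
  have hgeo := (hasSum_geometric_of_lt_one (r := ((3 + ρ) / 4) ^ 4) (by positivity)
      (pow_lt_one₀ (by linarith) (by linarith) four_ne_zero)).mul_left ((B * (1 - ρ) * A) ^ 2)
  have hterm2 : ∀ n, ‖d (n + 1) - ρ * d n‖ ^ 2 ≤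
      (B * (1 - ρ) * A) ^ 2 * (((3 + ρ) / 4) ^ 4) ^ n := by
    intro n
    calc _ ≤ (B * (1 - ρ) * (A * (((3 + ρ) / 4) ^ 2) ^ n)) ^ 2 := by
          have := hterm n
          gcongr
      _ = _ := by
          simp only [mul_pow, ← pow_mul]
          ring_nf
  have hsq : Summable fun n => ‖d (n + 1) - ρ * d n‖ ^ 2 :=
    hgeo.summable.of_nonneg_of_le (fun n => by positivity) hterm2
  have hS : ∑' n, ‖d (n + 1) - ρ * d n‖ ^ 2 ≤ 4 * B ^ 2 * A ^ 2 * (1 - ρ) := by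
    refine (hasSum_le hterm2 hsq.hasSum hgeo).trans ?_
    calc _ ≤ (B * (1 - ρ) * A) ^ 2 * (4 / (1 - ρ)) :=
          mul_le_mul_of_nonneg_left (inv_one_sub_sq_le hρm 4 four_ne_zero) (by positivity)
      _ = _ := by field_simp
  have hl : 0 < 2 * B * A * (1 - ρ) := by positivity
  have hL1 : ∫ θ in (0:ℝ)..2 * Real.pi, ‖circleSeries d θ‖ ≤ 4 * Real.pi * (B * A) := by
    refine (integral_norm_circleSeries_le hsd hd0 hρm hl hsq.hasSum).trans ?_
    calc _ ≤ Real.pi * (2 * B * A * (1 - ρ) * (1 - ρ)⁻¹ +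
          4 * B ^ 2 * A ^ 2 * (1 - ρ) / (2 * B * A * (1 - ρ))) := by gcongr
      _ = _ := by field_simp; ring
  have hcρ := continuous_circleSeries hsρ
  have hcσ := continuous_circleSeries hsσ
  have hcd := continuous_circleSeries hsd
  calc kernelMean ω ρ ≤ ∫ θ in (0:ℝ)..2 * Real.pi,
        (‖circleSeries (fun n => ((kernelCoeff ω n * σ ^ n : ℝ) : ℂ)) θ‖ +
          ‖circleSeries d θ‖) := by
        refine intervalIntegral.integral_mono_on Real.two_pi_pos.le
          (hcρ.norm.intervalIntegrable _ _)
          ((hcσ.norm.add hcd.norm).intervalIntegrable _ _) fun θ _ => ?_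
        rw [hd, circleSeries_sub hsρ hsσ]
        exact norm_le_norm_add_norm_sub' _ _
    _ = kernelMean ω σ + ∫ θ in (0:ℝ)..2 * Real.pi, ‖circleSeries d θ‖ :=
        intervalIntegral.integral_add (hcσ.norm.intervalIntegrable _ _)
          (hcd.norm.intervalIntegrable _ _)
    _ ≤ _ := by gcongr

/-- For a weight in `D̂ ∩ Ď` the circular means of the Bergman kernel are `O(1 / ω̂)`. -/
lemma exists_kernelMean_le (hω : IsRadialWeight ω)
    (hpos : ∀ r ∈ Ico (0:ℝ) 1, 0 < omegaHat ω r) (hD : InDhat ω) (hDc : InDcheck ω) :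
    ∃ M > (0:ℝ), ∀ ρ ∈ Ico (0:ℝ) 1, kernelMean ω ρ ≤ M / omegaHat ω ρ := by
  obtain ⟨C, hC, hD⟩ := hD
  obtain ⟨K, hK, c, hc, hDc⟩ := hDc
  have hc1 : 0 < c - 1 := by linarith
  have hK1 : 0 < K - 1 := by linarith
  have hπ := Real.pi_pos
  set G := 4 * Real.pi * ((2 * C ^ 2 + 1) * (K - 1)) * C ^ 2 with hG
  have hG0 : 0 < G := by positivity
  set M := 8 * Real.pi * C ^ 2 * K + G * c / (c - 1) with hM
  have hM0 : 0 < M := by positivity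
  have hM1 : 8 * Real.pi * C ^ 2 * K ≤ M := le_add_of_nonneg_right (by positivity)
  have hM2 : M / c + G ≤ M := by
    have h1 : G * c / (c - 1) ≤ M := le_add_of_nonneg_left (by positivity)
    rw [div_le_iff₀ hc1] at h1
    rw [← le_sub_iff_add_le, div_le_iff₀ (by linarith)]
    linarith
  have base : ∀ ρ ∈ Ico (0:ℝ) 1, 1 < K * (1 - ρ) → kernelMean ω ρ ≤ M / omegaHat ω ρ := by
    intro ρ hρ h
    have hρ1 : 0 < 1 - ρ := by linarith [hρ.2]
    have hp := hpos ρ hρ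
    refine (kernelMean_le_div_one_sub hω hpos hC hD hρ).trans ?_
    have : 4 / (1 - ρ) ≤ 4 * K := by rw [div_le_iff₀ hρ1]; linarith
    calc _ ≤ 2 * Real.pi * (C ^ 2 / omegaHat ω ρ * (4 * K)) := by gcongr
      _ = 8 * Real.pi * C ^ 2 * K / omegaHat ω ρ := by ring
      _ ≤ _ := by gcongr
  have main : ∀ k : ℕ, ∀ ρ ∈ Ico (0:ℝ) 1, 1 ≤ K ^ k * (1 - ρ) →
      kernelMean ω ρ ≤ M / omegaHat ω ρ := by
    intro k
    induction k with
    | zero =>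
      intro ρ hρ h
      refine base ρ hρ ?_
      rw [pow_zero, one_mul] at h
      nlinarith
    | succ k ih =>
      intro ρ hρ h
      rcases lt_or_ge 1 (K * (1 - ρ)) with h1 | h1
      · exact base ρ hρ h1
      · have hρ1 : 0 < 1 - ρ := by linarith [hρ.2]
        set σ := 1 - K * (1 - ρ) with hσ
        have hσm : σ ∈ Ico (0:ℝ) 1 := ⟨by linarith, by nlinarith⟩
        have hp := hpos ρ hρ
        have hpσ := hpos σ hσm
        have h2 := hDc σ hσm
        have h3 : 1 - (1 - σ) / K = ρ := by rw [hσ]; field_simp; ring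
        rw [h3] at h2
        have h4 := ih σ hσm (by rw [hσ]; rw [pow_succ] at h; linarith)
        have h5 := kernelMean_le_add hω hpos hC hD hK hρ.2 hσm.1 (by rw [hσ]; ring)
        refine h5.trans ?_
        calc _ ≤ M / (c * omegaHat ω ρ) + G / omegaHat ω ρ := by
              gcongr
              · exact h4.trans (by gcongr)
              · rw [hG]; apply le_of_eq; ring
          _ = (M / c + G) / omegaHat ω ρ := by field_simp
          _ ≤ _ := by gcongr
  refine ⟨M, hM0, fun ρ hρ => ?_⟩
  have hρ1 : 0 < 1 - ρ := by linarith [hρ.2]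
  obtain ⟨k, hk⟩ := pow_unbounded_of_one_lt (1 - ρ)⁻¹ hK
  exact main k ρ hρ ((inv_le_iff_one_le_mul₀ hρ1).1 hk.le)

end KernelMean

lemma setLIntegral_Ioc_rpow_sub_one {α R : ℝ} (hα : 0 < α) (hR : 0 ≤ R) :
    ∫⁻ t in Ioc 0 R, ENNReal.ofReal (t ^ (α - 1)) = ENNReal.ofReal (R ^ α / α) := by
  have h := integral_rpow (a := 0) (b := R) (r := α - 1) (Or.inl (by linarith))
  rw [← ofReal_integral_eq_lintegral_ofReal, ← intervalIntegral.integral_of_le hR, h]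
  · simp [Real.zero_rpow hα.ne']
  · exact (intervalIntegrable_iff_integrableOn_Ioc_of_le hR).1
      (intervalIntegral.intervalIntegrable_rpow' (by linarith))
  · exact (ae_restrict_mem measurableSet_Ioc).mono fun t ht => Real.rpow_nonneg ht.1.le _

lemma setLIntegral_Ioi_rpow_sub_two {α R : ℝ} (hα : α < 1) (hR : 0 < R) :
    ∫⁻ t in Ioi R, ENNReal.ofReal (t ^ (α - 2)) = ENNReal.ofReal (R ^ (α - 1) / (1 - α)) := by
  have h := integral_Ioi_rpow_of_lt (a := α - 2) (by linarith) hR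
  rw [← ofReal_integral_eq_lintegral_ofReal, h]
  · congr 1
    rw [show α - 2 + 1 = α - 1 by ring, ← neg_sub α 1, div_neg, neg_div]
  · exact integrableOn_Ioi_rpow_of_lt (by linarith) hR
  · exact (ae_restrict_mem measurableSet_Ioi).mono
      fun t ht => Real.rpow_nonneg (hR.trans ht).le _

section WeakType

variable {X : Type*} [MeasurableSpace X] {μ : Measure X} {f : X → ℝ} {α R : ℝ}

lemma lintegral_min_rpow_le_of_meas_lt_le (hf : AEMeasurable f μ) (hf0 : 0 ≤ᵐ[μ] f)
    (hμ : ∀ t > 0, μ {a | t < f a} ≤ ENNReal.ofReal t⁻¹) (hα : 0 < α) (hR : 0 < R) :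
    ∫⁻ a, ENNReal.ofReal (min (f a) R ^ (1 + α)) ∂μ ≤
      ENNReal.ofReal ((1 + α) * (R ^ α / α)) := by
  rw [lintegral_rpow_eq_lintegral_meas_lt_mul μ (f := fun a => min (f a) R)
    (hf0.mono fun a ha => le_min ha hR.le) (by fun_prop) (by linarith : 0 < 1 + α),
    ENNReal.ofReal_mul (by linarith), ← setLIntegral_Ioc_rpow_sub_one hα hR.le]
  gcongr _ * ?_
  rw [← Ioc_union_Ioi_eq_Ioi hR.le]
  refine (lintegral_union_le _ _ _).trans ?_
  have h2 : ∫⁻ t in Ioi R, μ {a | t < min (f a) R} * ENNReal.ofReal (t ^ (1 + α - 1)) = 0 := by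
    rw [setLIntegral_congr_fun measurableSet_Ioi (g := fun _ => 0), lintegral_zero]
    intro t ht
    have : {a | t < min (f a) R} = ∅ := by
      ext a
      simp only [mem_ofPred_eq, lt_min_iff, mem_empty_iff_false, iff_false]
      exact fun h => (lt_asymm h.2 ht)
    simp only [this, measure_empty, zero_mul]
  rw [h2, add_zero]
  refine setLIntegral_mono' measurableSet_Ioc fun t ht => ?_
  have ht0 : 0 < t := ht.1
  calc _ ≤ ENNReal.ofReal t⁻¹ * ENNReal.ofReal (t ^ (1 + α - 1)) := by
        gcongr
        exact (measure_mono fun a (ha : t < min (f a) R) => ha.trans_le (min_le_left _ _)).trans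
          (hμ t ht0)
    _ = ENNReal.ofReal (t ^ (α - 1)) := by
        rw [← ENNReal.ofReal_mul (by positivity), add_sub_cancel_left, Real.rpow_sub_one ht0.ne',
          inv_mul_eq_div]

lemma setLIntegral_rpow_le_of_meas_lt_le (hf : AEMeasurable f μ) (hf0 : 0 ≤ᵐ[μ] f)
    (hμ : ∀ t > 0, μ {a | t < f a} ≤ ENNReal.ofReal t⁻¹) (hα : 0 < α) (hα1 : α < 1)
    (hR : 0 < R) :
    ∫⁻ a in {a | R < f a}, ENNReal.ofReal (f a ^ α) ∂μ ≤
      ENNReal.ofReal (α * (R⁻¹ * (R ^ α / α) + R ^ (α - 1) / (1 - α))) := by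
  have h1α : 0 < 1 - α := by linarith
  rw [lintegral_rpow_eq_lintegral_meas_lt_mul _ (ae_restrict_of_ae hf0) hf.restrict hα,
    ENNReal.ofReal_mul hα.le, ENNReal.ofReal_add (by positivity) (by positivity),
    ENNReal.ofReal_mul (by positivity), ← setLIntegral_Ioc_rpow_sub_one hα hR.le,
    ← setLIntegral_Ioi_rpow_sub_two hα1 hR]
  gcongr _ * ?_
  rw [← lintegral_const_mul' (ENNReal.ofReal R⁻¹) _ ENNReal.ofReal_ne_top, ← Ioc_union_Ioi_eq_Ioi hR.le]
  refine (lintegral_union_le _ _ _).trans (add_le_add ?_ ?_)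
  · refine setLIntegral_mono' measurableSet_Ioc fun t ht => ?_
    gcongr
    refine (measure_mono (subset_univ _)).trans ?_
    rw [Measure.restrict_apply_univ]
    exact hμ R hR
  · refine setLIntegral_mono' measurableSet_Ioi fun t ht => ?_
    have ht0 : 0 < t := hR.trans ht
    calc _ ≤ ENNReal.ofReal t⁻¹ * ENNReal.ofReal (t ^ (α - 1)) := by
          gcongr
          exact (Measure.restrict_apply_le _ _).trans (hμ t ht0)
      _ = ENNReal.ofReal (t ^ (α - 2)) := by
          rw [← ENNReal.ofReal_mul (by positivity), show α - 2 = α - 1 - 1 by ring,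
            Real.rpow_sub_one ht0.ne' (α - 1), inv_mul_eq_div]

lemma exists_lintegral_rpow_mul_min_le (hf : AEMeasurable f μ) (hf0 : 0 ≤ᵐ[μ] f)
    (hμ : ∀ t > 0, μ {a | t < f a} ≤ ENNReal.ofReal t⁻¹) (hα : 0 < α) (hα1 : α < 1) :
    ∃ C > (0:ℝ), ∀ R > 0, ∫⁻ a, ENNReal.ofReal (f a ^ α * min (f a) R) ∂μ ≤
      ENNReal.ofReal (C * R ^ α) := by
  have h1α : 0 < 1 - α := by linarith
  refine ⟨(1 + α) / α + α * (1 / α + 1 / (1 - α)), by positivity, fun R hR => ?_⟩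
  have hset : NullMeasurableSet {a | R < f a} μ := nullMeasurableSet_lt aemeasurable_const hf
  calc ∫⁻ a, ENNReal.ofReal (f a ^ α * min (f a) R) ∂μ
      ≤ ∫⁻ a, (ENNReal.ofReal (min (f a) R ^ (1 + α)) +
          {a | R < f a}.indicator (fun a => ENNReal.ofReal R * ENNReal.ofReal (f a ^ α)) a) ∂μ := by
        refine lintegral_mono_ae (hf0.mono fun a ha => ?_)
        rcases lt_or_ge R (f a) with h | h
        · rw [indicator_of_mem (show a ∈ {a | R < f a} from h), min_eq_right h.le,
            ← ENNReal.ofReal_mul hR.le, mul_comm]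
          exact le_add_self
        · rw [min_eq_left h]
          refine le_add_right (ENNReal.ofReal_le_ofReal (le_of_eq ?_))
          rw [Real.rpow_add_of_nonneg ha zero_le_one hα.le, Real.rpow_one, mul_comm]
    _ = ∫⁻ a, ENNReal.ofReal (min (f a) R ^ (1 + α)) ∂μ +
          ENNReal.ofReal R * ∫⁻ a in {a | R < f a}, ENNReal.ofReal (f a ^ α) ∂μ := by
        rw [lintegral_add_left' (by fun_prop), lintegral_indicator₀ hset,
          lintegral_const_mul' _ _ ENNReal.ofReal_ne_top]
    _ ≤ ENNReal.ofReal ((1 + α) * (R ^ α / α)) + ENNReal.ofReal R *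
          ENNReal.ofReal (α * (R⁻¹ * (R ^ α / α) + R ^ (α - 1) / (1 - α))) := by
        gcongr
        · exact lintegral_min_rpow_le_of_meas_lt_le hf hf0 hμ hα hR
        · exact setLIntegral_rpow_le_of_meas_lt_le hf hf0 hμ hα hα1 hR
    _ = _ := by
        rw [← ENNReal.ofReal_mul hR.le, ← ENNReal.ofReal_add (by positivity) (by positivity),
          Real.rpow_sub_one hR.ne']
        congr 1
        field_simp

end WeakType

section Schur

variable {ω : ℝ → ℝ}

lemma weightMeasure_lt_inv_omegaHat_le (hω : IsRadialWeight ω)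
    (hpos : ∀ r ∈ Ico (0:ℝ) 1, 0 < omegaHat ω r) {t : ℝ} (ht : 0 < t) :
    weightMeasure ω {a | t < (omegaHat ω a)⁻¹} ≤ ENNReal.ofReal t⁻¹ := by
  obtain ⟨s, hs, hst, hsub⟩ : ∃ s ∈ Icc (0:ℝ) 1, omegaHat ω s ≤ t⁻¹ ∧
      ∀ a ∈ Ioo (0:ℝ) 1, omegaHat ω a < t⁻¹ → s ≤ a := by
    rcases le_or_gt (omegaHat ω 0) t⁻¹ with h | h
    · exact ⟨0, by simp, h, fun a ha _ => ha.1.le⟩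
    · have h1 : omegaHat ω 1 = 0 := by simp [omegaHat]
      obtain ⟨s, hs, hst⟩ := intermediate_value_Icc' zero_le_one hω.continuousOn_omegaHat
        (show t⁻¹ ∈ Icc (omegaHat ω 1) (omegaHat ω 0) from
          ⟨by rw [h1]; positivity, h.le⟩)
      refine ⟨s, hs, hst.le, fun a ha hat => ?_⟩
      by_contra! hlt
      have := hω.omegaHat_anti ha.1.le hlt.le hs.2
      linarith
  calc weightMeasure ω {a | t < (omegaHat ω a)⁻¹} ≤ weightMeasure ω (Ici s) := by
        refine measure_mono_ae ((ae_weightMeasure_mem_Ioo ω).mono fun a ha hat => ?_)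
        refine hsub a ha ?_
        exact (lt_inv_comm₀ ht (hpos a ⟨ha.1.le, ha.2⟩)).1 hat
    _ = ENNReal.ofReal (omegaHat ω s) := hω.weightMeasure_Ici hs
    _ ≤ _ := ENNReal.ofReal_le_ofReal hst

lemma MpE_one_bergmanKernel {C : ℝ} (hω : IsRadialWeight ω)
    (hpos : ∀ r ∈ Ico (0:ℝ) 1, 0 < omegaHat ω r) (hC : 0 < C)
    (hD : ∀ r ∈ Ico (0:ℝ) 1, omegaHat ω r ≤ C * omegaHat ω ((1 + r) / 2))
    {r s : ℝ} (hrs : s * r ∈ Ico (0:ℝ) 1) :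
    MpE 1 s (fun z => bergmanKernel ω ((r:ℝ) : ℂ) z) =
      ENNReal.ofReal (1 / (2 * Real.pi) * kernelMean ω (s * r)) := by
  have hker : ∀ θ, bergmanKernel ω (r:ℂ) (circlePt s θ) =
      circleSeries (fun n => ((kernelCoeff ω n * (s * r) ^ n : ℝ) : ℂ)) θ := by
    intro θ
    refine tsum_congr fun n => ?_
    have : (2 * (n:ℝ) + 1) = ((2 * n + 1 : ℕ) : ℝ) := by push_cast; ring
    rw [this, momentW_natCast, circlePt, Complex.conj_ofReal]
    simp only [kernelCoeff]
    push_cast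
    rw [mul_pow, mul_pow, mul_pow, div_eq_mul_inv]
    ring
  have hs := summable_kernelCoeff_mul_pow hω hpos hC hD hrs
  simp only [MpE, Real.rpow_one, div_one, ENNReal.rpow_one, hker]
  rw [ENNReal.ofReal_mul (by positivity), kernelMean,
    intervalIntegral.integral_of_le Real.two_pi_pos.le, integral_Ioc_eq_integral_Ioo,
    ofReal_integral_eq_lintegral_ofReal]
  · exact (intervalIntegrable_iff_integrableOn_Ioo_of_le Real.two_pi_pos.le).1
      ((continuous_circleSeries hs).norm.intervalIntegrable _ _)
  · exact ae_of_all _ fun θ => norm_nonneg _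

/-- One half of the Schur test, for an arbitrary exponent in `(0,1)`. -/
lemma exists_lintegral_rpow_omegaHat_mul_MpE_le (hω : IsRadialWeight ω)
    (hpos : ∀ r ∈ Ico (0:ℝ) 1, 0 < omegaHat ω r) (hD : InDhat ω) (hDc : InDcheck ω)
    {α : ℝ} (hα : 0 < α) (hα1 : α < 1) :
    ∃ C > (0:ℝ), ∀ r ∈ Ico (0:ℝ) 1,
      ∫⁻ s in Ioo (0:ℝ) 1, ENNReal.ofReal (omegaHat ω s ^ (-α) * s * ω s) *
        MpE 1 s (fun z => bergmanKernel ω ((r:ℝ) : ℂ) z) ≤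
      ENNReal.ofReal (C * omegaHat ω r ^ (-α)) := by
  obtain ⟨M, hM, hmean⟩ := exists_kernelMean_le hω hpos hD hDc
  obtain ⟨C₀, hC₀, hD⟩ := hD
  have hmeas : AEMeasurable (fun s => (omegaHat ω s)⁻¹) (volume.restrict (Ioo 0 1)) :=
    ((hω.continuousOn_omegaHat.mono Ioo_subset_Icc_self).aemeasurable measurableSet_Ioo).inv
  obtain ⟨C, hC, hint⟩ := exists_lintegral_rpow_mul_min_le (μ := weightMeasure ω)
    (f := fun s => (omegaHat ω s)⁻¹)
    (hmeas.mono_ac (withDensity_absolutelyContinuous _ _))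
    ((ae_weightMeasure_mem_Ioo ω).mono fun s hs => (inv_pos.2 (hpos s ⟨hs.1.le, hs.2⟩)).le)
    (fun t ht => weightMeasure_lt_inv_omegaHat_le hω hpos ht) hα hα1
  refine ⟨M * C, by positivity, fun r hr => ?_⟩
  have hpr := hpos r hr
  calc _ ≤ ∫⁻ s in Ioo (0:ℝ) 1, ENNReal.ofReal M * ENNReal.ofReal
        ((omegaHat ω s)⁻¹ ^ α * min (omegaHat ω s)⁻¹ (omegaHat ω r)⁻¹ * ω s) := by
        refine setLIntegral_mono' measurableSet_Ioo fun s hs => ?_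
        have hps := hpos s ⟨hs.1.le, hs.2⟩
        have hωs := hω.1 s ⟨hs.1.le, hs.2⟩
        have hs0 := hs.1
        have hr0 := hr.1
        have hsr1 : s * r ≤ s := mul_le_of_le_one_right hs0.le hr.2.le
        have hsr2 : s * r ≤ r := mul_le_of_le_one_left hr0 hs.2.le
        have hsr : s * r ∈ Ico (0:ℝ) 1 := ⟨by positivity, hsr1.trans_lt hs.2⟩
        have hk0 : 0 ≤ kernelMean ω (s * r) :=
          intervalIntegral.integral_nonneg Real.two_pi_pos.le fun θ _ => norm_nonneg _
        have hm : 1 / (2 * Real.pi) * kernelMean ω (s * r) ≤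
            M * min (omegaHat ω s)⁻¹ (omegaHat ω r)⁻¹ := by
          have hπ : 1 / (2 * Real.pi) ≤ 1 := by
            rw [div_le_one Real.two_pi_pos]
            linarith [Real.two_le_pi]
          calc _ ≤ 1 * kernelMean ω (s * r) := by gcongr
            _ ≤ M * (omegaHat ω (s * r))⁻¹ := by
                rw [one_mul, ← div_eq_mul_inv]; exact hmean _ hsr
            _ ≤ _ := by
                gcongr
                exact le_min (inv_anti₀ hps (hω.omegaHat_anti hsr.1 hsr1 hs.2.le))
                  (inv_anti₀ hpr (hω.omegaHat_anti hsr.1 hsr2 hr.2.le))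
        have hmin : 0 < min (omegaHat ω s)⁻¹ (omegaHat ω r)⁻¹ :=
          lt_min (inv_pos.2 hps) (inv_pos.2 hpr)
        rw [MpE_one_bergmanKernel hω hpos hC₀ hD hsr, ← ENNReal.ofReal_mul (by positivity),
          ← ENNReal.ofReal_mul hM.le]
        refine ENNReal.ofReal_le_ofReal ?_
        rw [Real.inv_rpow hps.le, ← Real.rpow_neg hps.le]
        calc _ ≤ omegaHat ω s ^ (-α) * 1 * ω s *
              (M * min (omegaHat ω s)⁻¹ (omegaHat ω r)⁻¹) := by
              have : 0 ≤ 1 / (2 * Real.pi) * kernelMean ω (s * r) := by positivity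
              gcongr
              exact hs.2.le
          _ = _ := by ring
    _ = ENNReal.ofReal M * ∫⁻ s, ENNReal.ofReal
        ((omegaHat ω s)⁻¹ ^ α * min (omegaHat ω s)⁻¹ (omegaHat ω r)⁻¹) ∂weightMeasure ω := by
        rw [lintegral_const_mul' _ _ ENNReal.ofReal_ne_top, hω.lintegral_weightMeasure]
        · exact (hmeas.pow_const _).mul (hmeas.min aemeasurable_const)
        · intro s hs
          have hps := hpos s ⟨hs.1.le, hs.2⟩
          have : 0 < min (omegaHat ω s)⁻¹ (omegaHat ω r)⁻¹ :=
            lt_min (inv_pos.2 hps) (inv_pos.2 hpr)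
          positivity
    _ ≤ ENNReal.ofReal M * ENNReal.ofReal (C * (omegaHat ω r)⁻¹ ^ α) := by
        gcongr
        exact hint _ (inv_pos.2 hpr)
    _ = _ := by
        rw [← ENNReal.ofReal_mul hM.le, Real.inv_rpow hpr.le, ← Real.rpow_neg hpr.le, mul_assoc]

end Schur

/-- Schur-test estimates for the kernel `M₁(s,B^ω_r)` with the test
function `h(r) = ω̂(r)^{-1/(q q')}`, for `ω ∈ D = D̂ ∩ Ď`. -/
theorem schur_test_estimates
    (ω : ℝ → ℝ) (hω : IsRadialWeight ω)
    (hpos : ∀ r ∈ Set.Ico (0:ℝ) 1, 0 < omegaHat ω r)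
    (hD : InDhat ω) (hDc : InDcheck ω)
    (q q' : ℝ) (hq : 1 < q) (hq' : q' = q / (q - 1))
    (h : ℝ → ℝ) (hh : h = fun r => omegaHat ω r ^ (-(1 / (q * q')))) :
    ∃ C > (0:ℝ),
      (∀ r ∈ Set.Ico (0:ℝ) 1,
        (∫⁻ s in Set.Ioo (0:ℝ) 1,
            ENNReal.ofReal (h s ^ q' * s * ω s) *
              MpE 1 s (fun z => bergmanKernel ω ((r:ℝ) : ℂ) z))
          ≤ ENNReal.ofReal (C * h r ^ q')) ∧
      (∀ s ∈ Set.Ico (0:ℝ) 1,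
        (∫⁻ r in Set.Ioo (0:ℝ) 1,
            ENNReal.ofReal (h r ^ q * r * ω r) *
              MpE 1 r (fun z => bergmanKernel ω ((s:ℝ) : ℂ) z))
          ≤ ENNReal.ofReal (C * h s ^ q)) := by
  have hq0 : 0 < q := by linarith
  have hq1 : 0 < q - 1 := by linarith
  have hq'0 : 0 < q' := by rw [hq']; positivity
  have hq'1 : 1 < q' := by rw [hq', one_lt_div hq1]; linarith
  obtain ⟨C₁, hC₁, h₁⟩ := exists_lintegral_rpow_omegaHat_mul_MpE_le hω hpos hD hDc
    (α := 1 / q) (by positivity) (by rw [div_lt_one hq0]; exact hq)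
  obtain ⟨C₂, hC₂, h₂⟩ := exists_lintegral_rpow_omegaHat_mul_MpE_le hω hpos hD hDc
    (α := 1 / q') (by positivity) (by rw [div_lt_one hq'0]; exact hq'1)
  have hpow₁ : ∀ r ∈ Ico (0:ℝ) 1, h r ^ q' = omegaHat ω r ^ (-(1 / q)) := by
    intro r hr
    rw [hh, ← Real.rpow_mul (hpos r hr).le]
    congr 1
    field_simp
  have hpow₂ : ∀ r ∈ Ico (0:ℝ) 1, h r ^ q = omegaHat ω r ^ (-(1 / q')) := by
    intro r hr
    rw [hh, ← Real.rpow_mul (hpos r hr).le]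
    congr 1
    field_simp
  refine ⟨C₁ + C₂, by positivity, fun r hr => ?_, fun r hr => ?_⟩
  · rw [hpow₁ r hr, setLIntegral_congr_fun measurableSet_Ioo fun s hs => by
      rw [hpow₁ s ⟨hs.1.le, hs.2⟩]]
    refine (h₁ r hr).trans (ENNReal.ofReal_le_ofReal ?_)
    have := Real.rpow_nonneg (hpos r hr).le (-(1 / q))
    gcongr
    linarith
  · rw [hpow₂ r hr, setLIntegral_congr_fun measurableSet_Ioo fun s hs => by
      rw [hpow₂ s ⟨hs.1.le, hs.2⟩]]
    refine (h₂ r hr).trans (ENNReal.ofReal_le_ofReal ?_)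
    have := Real.rpow_nonneg (hpos r hr).le (-(1 / q'))
    gcongr
    linarith
end
end

section
/- Let ω be a radial weight (with ω̂(r)>0 for all 0≤r<1) and let 1≤p<∞. Then for every measurable function f on D and every 0≤r<1: M_p(r, P_ω^+ f) ≤ 2·∫_0^1 M_p(s,f)·M_1(s, B^ω_r)·s·ω(s) ds (as an inequality in [0,∞]). -/
open MeasureTheory Filter Set
open scoped ENNReal

noncomputable section

/-- **Minkowski's integral inequality** for `[0,∞]`-valued functions. -/
theorem lintegral_rpow_lintegral_le {α β : Type*} [MeasurableSpace α] [MeasurableSpace β]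
    (μ : Measure α) (ν : Measure β) [SFinite μ] [SFinite ν] {H : α → β → ℝ≥0∞}
    (hH : Measurable (Function.uncurry H)) {p : ℝ} (hp : 1 ≤ p) :
    (∫⁻ y, (∫⁻ x, H x y ∂μ) ^ p ∂ν) ^ (1 / p) ≤
      ∫⁻ x, (∫⁻ y, H x y ^ p ∂ν) ^ (1 / p) ∂μ := by
  have hp0 : 0 < p := by linarith
  have hHp : Measurable fun z : α × β => H z.1 z.2 ^ p := hH.pow_const p
  have hHx (x : α) : Measurable fun y => H x y ^ p := hHp.comp measurable_prodMk_left
  set N : α → ℝ≥0∞ := fun x => (∫⁻ y, H x y ^ p ∂ν) ^ (1 / p) with hN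
  have hNp (x) : N x ^ p = ∫⁻ y, H x y ^ p ∂ν := by
    rw [hN, ← ENNReal.rpow_mul, one_div_mul_cancel hp0.ne', ENNReal.rpow_one]
  have hNm : Measurable N := (hHp.lintegral_prod_right').pow_const _
  rcases eq_or_ne (∫⁻ x, N x ∂μ) ⊤ with hA | hA
  · rw [hA]; exact le_top
  have hfin : ∀ᵐ x ∂μ, N x < ⊤ := ae_lt_top hNm hA
  have hset : MeasurableSet {z : α × β | N z.1 = 0 → H z.1 z.2 = 0} := by
    have h1 : MeasurableSet {z : α × β | N z.1 = 0} :=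
      measurableSet_eq_fun (hNm.comp measurable_fst) measurable_const
    have h2 : MeasurableSet {z : α × β | H z.1 z.2 = 0} :=
      measurableSet_eq_fun hH measurable_const
    exact h1.imp h2
  have hzero : ∀ᵐ y ∂ν, ∀ᵐ x ∂μ, N x = 0 → H x y = 0 := by
    rw [← Measure.ae_ae_comm hset]
    refine Eventually.of_forall fun x => ?_
    by_cases hx : N x = 0
    · have h0 : ∫⁻ y, H x y ^ p ∂ν = 0 := by rw [← hNp, hx, ENNReal.zero_rpow_of_pos hp0]
      rw [lintegral_eq_zero_iff (hHx x)] at h0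
      filter_upwards [h0] with y hy _
      simpa [ENNReal.rpow_eq_zero_iff, hp0, hp0.le, hp0.not_gt] using hy
    · simp [hx]
  have hq : 0 ≤ 1 - 1 / p := by
    rw [sub_nonneg, div_le_one hp0]; exact hp
  have key : ∀ᵐ y ∂ν, (∫⁻ x, H x y ∂μ) ^ p ≤
      (∫⁻ x, N x ∂μ) ^ (p - 1) * ∫⁻ x, H x y ^ p * N x ^ (1 - p) ∂μ := by
    filter_upwards [hzero] with y hy
    have hHy : Measurable fun x => H x y := hH.comp measurable_prodMk_right
    have h1 : ∫⁻ x, H x y ∂μ ≤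
        ∫⁻ x, N x ^ (1 - 1 / p) * (H x y ^ p * N x ^ (1 - p)) ^ (1 / p) ∂μ := by
      refine lintegral_mono_ae ?_
      filter_upwards [hy, hfin] with x hx hxt
      by_cases h0 : N x = 0
      · simp [hx h0]
      · rw [ENNReal.mul_rpow_of_nonneg _ _ (by positivity),
          ← ENNReal.rpow_mul (H x y), ← ENNReal.rpow_mul (N x), mul_one_div_cancel hp0.ne', ENNReal.rpow_one, mul_left_comm,
          ← ENNReal.rpow_add _ _ h0 hxt.ne]
        have : 1 - 1 / p + (1 - p) * (1 / p) = 0 := by field_simp; ring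
        rw [this, ENNReal.rpow_zero, mul_one]
    have h2 := h1.trans (ENNReal.lintegral_mul_norm_pow_le (μ := μ) hNm.aemeasurable
      ((hHy.pow_const p).mul (hNm.pow_const (1 - p))).aemeasurable hq
      (by positivity) (by ring))
    refine (ENNReal.rpow_le_rpow h2 hp0.le).trans_eq ?_
    rw [ENNReal.mul_rpow_of_nonneg _ _ hp0.le, ← ENNReal.rpow_mul, ← ENNReal.rpow_mul,
      one_div_mul_cancel hp0.ne', ENNReal.rpow_one, sub_mul, one_mul,
      one_div_mul_cancel hp0.ne']
    rfl
  have hprod : Measurable fun z : β × α => H z.2 z.1 ^ p * N z.2 ^ (1 - p) :=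
    (hHp.comp measurable_swap).mul ((hNm.comp measurable_snd).pow_const _)
  have hmain : ∫⁻ y, (∫⁻ x, H x y ∂μ) ^ p ∂ν ≤ (∫⁻ x, N x ∂μ) ^ p := calc
    _ ≤ ∫⁻ y, (∫⁻ x, N x ∂μ) ^ (p - 1) * ∫⁻ x, H x y ^ p * N x ^ (1 - p) ∂μ ∂ν :=
        lintegral_mono_ae key
    _ = (∫⁻ x, N x ∂μ) ^ (p - 1) * ∫⁻ y, ∫⁻ x, H x y ^ p * N x ^ (1 - p) ∂μ ∂ν :=
        lintegral_const_mul _ hprod.lintegral_prod_right'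
    _ = (∫⁻ x, N x ∂μ) ^ (p - 1) * ∫⁻ x, N x ^ p * N x ^ (1 - p) ∂μ := by
        rw [lintegral_lintegral_swap hprod.aemeasurable]
        congr 1
        refine lintegral_congr fun x => ?_
        rw [lintegral_mul_const _ (hHx x), hNp]
    _ ≤ (∫⁻ x, N x ∂μ) ^ (p - 1) * ∫⁻ x, N x ∂μ := by
        refine mul_le_mul_right (α := ℝ≥0∞) ?_ _
        refine lintegral_mono_ae ?_
        filter_upwards [hfin] with x hx
        by_cases h0 : N x = 0
        · simp [h0, ENNReal.zero_rpow_of_pos hp0]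
        · rw [← ENNReal.rpow_add _ _ h0 hx.ne]; simp
    _ = (∫⁻ x, N x ∂μ) ^ p := by
        nth_rewrite 2 [← ENNReal.rpow_one (∫⁻ x, N x ∂μ)]
        rw [← ENNReal.rpow_add_of_nonneg _ _ (by linarith) zero_le_one, sub_add_cancel]
  refine (ENNReal.rpow_le_rpow hmain (by positivity)).trans_eq ?_
  rw [← ENNReal.rpow_mul, mul_one_div_cancel hp0.ne', ENNReal.rpow_one]

/-- The integral of a periodic function over a period does not depend on the period chosen. -/
theorem Function.Periodic.setLIntegral_Ioo_eq {T : ℝ} (hT : 0 < T) {g : ℝ → ℝ≥0∞}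
    (hg : Function.Periodic g T) (a b : ℝ) :
    ∫⁻ x in Ioo a (a + T), g x = ∫⁻ x in Ioo b (b + T), g x := by
  have : Fact (0 < T) := ⟨hT⟩
  have h (c : ℝ) : ∫⁻ x in Ioo c (c + T), g x = ∫⁻ x : AddCircle T, hg.lift x := by
    rw [← AddCircle.lintegral_preimage T c, setLIntegral_congr Ioo_ae_eq_Ioc]
    simp only [Function.Periodic.lift_coe]
  rw [h, h]

/-- The integral of a periodic function over a period is translation invariant. -/
theorem Function.Periodic.setLIntegral_Ioo_add_right {T : ℝ} (hT : 0 < T) {g : ℝ → ℝ≥0∞}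
    (hg : Function.Periodic g T) (t : ℝ) :
    ∫⁻ x in Ioo 0 T, g (x + t) = ∫⁻ x in Ioo 0 T, g x := by
  have h := (measurePreserving_add_right (volume : Measure ℝ) t).setLIntegral_comp_preimage_emb
    (measurableEmbedding_addRight t) g (Ioo (0 + t) (T + t))
  have hpre : (fun x => x + t) ⁻¹' Ioo (0 + t) (T + t) = Ioo 0 T := by ext x; simp
  rw [hpre] at h
  rw [h, add_comm T t, zero_add, hg.setLIntegral_Ioo_eq hT t 0, zero_add]

theorem measurable_bergmanKernel (ω : ℝ → ℝ) (a : ℂ) : Measurable (bergmanKernel ω a) :=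
  Measurable.tsum fun n => by fun_prop

theorem measurable_circlePt : Measurable fun x : ℝ × ℝ => circlePt x.1 x.2 := by
  unfold circlePt
  fun_prop

theorem measurable_circlePt_right (s : ℝ) : Measurable (circlePt s) := by
  unfold circlePt
  fun_prop

theorem circlePt_periodic (s : ℝ) : Function.Periodic (circlePt s) (2 * Real.pi) := fun θ => by
  have := Complex.exp_mul_I_periodic (θ : ℂ)
  simp only [circlePt]
  push_cast
  exact congrArg _ this

theorem norm_circlePt {s : ℝ} (hs : 0 ≤ s) (θ : ℝ) : ‖circlePt s θ‖ = s := by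
  simp [circlePt, Complex.norm_exp_ofReal_mul_I, abs_of_nonneg hs]

/-- Rotation invariance of the kernel of a radial weight. -/
theorem bergmanKernel_circlePt (ω : ℝ → ℝ) (r s t θ : ℝ) :
    bergmanKernel ω (circlePt r t) (circlePt s (θ + t)) =
      bergmanKernel ω (r : ℂ) (circlePt s θ) := by
  have h : circlePt s (θ + t) * (starRingEnd ℂ) (circlePt r t) =
      circlePt s θ * (starRingEnd ℂ) (r : ℂ) := by
    simp only [circlePt, map_mul, Complex.conj_ofReal, ← Complex.exp_conj, Complex.conj_I]
    rw [mul_mul_mul_comm, ← Complex.exp_add]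
    push_cast
    ring_nf
  simp only [bergmanKernel, h]

/-- Integration over the unit disc in polar coordinates. -/
theorem setLIntegral_ball_eq {h : ℂ → ℝ≥0∞} (hh : Measurable h) :
    ∫⁻ ζ in Metric.ball (0 : ℂ) 1, h ζ =
      ∫⁻ s in Ioo (0 : ℝ) 1, ENNReal.ofReal s *
        ∫⁻ θ in Ioo (0 : ℝ) (2 * Real.pi), h (circlePt s θ) := by
  have hball : MeasurableSet (Metric.ball (0 : ℂ) 1) := measurableSet_ball
  have hsymm (x : ℝ × ℝ) : Complex.polarCoord.symm x = circlePt x.1 x.2 := by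
    rw [Complex.polarCoord_symm_apply, circlePt, Complex.exp_mul_I]
    push_cast
    rfl
  have hm : Measurable ((Metric.ball (0 : ℂ) 1).indicator h) := hh.indicator hball
  rw [← lintegral_indicator hball, ← Complex.lintegral_comp_polarCoord_symm]
  simp_rw [hsymm, polarCoord_target, smul_eq_mul]
  have hpm : Measurable fun x : ℝ × ℝ =>
      ENNReal.ofReal x.1 * (Metric.ball (0 : ℂ) 1).indicator h (circlePt x.1 x.2) :=
    measurable_fst.ennreal_ofReal.mul (hm.comp measurable_circlePt)
  rw [Measure.volume_eq_prod, ← Measure.prod_restrict, lintegral_prod _ hpm.aemeasurable]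
  have hsub : Ioo (0 : ℝ) 1 ⊆ Ioi 0 := fun x hx => hx.1
  rw [← lintegral_indicator measurableSet_Ioi, ← lintegral_indicator measurableSet_Ioo]
  refine lintegral_congr fun s => ?_
  by_cases hs0 : 0 < s
  swap
  · simp [Set.indicator, hs0]
  by_cases hs1 : s < 1
  swap
  · simp [Set.indicator, hs0, hs1, norm_circlePt hs0.le]
  have hper : Function.Periodic (fun θ => h (circlePt s θ)) (2 * Real.pi) :=
    (circlePt_periodic s).comp h
  have hshift := hper.setLIntegral_Ioo_eq Real.two_pi_pos (-Real.pi) 0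
  rw [zero_add, show -Real.pi + 2 * Real.pi = Real.pi by ring] at hshift
  rw [indicator_of_mem (mem_Ioi.2 hs0), indicator_of_mem (mem_Ioo.2 ⟨hs0, hs1⟩), ← hshift,
    lintegral_const_mul' _ _ ENNReal.ofReal_ne_top]
  simp [Set.indicator, norm_circlePt hs0.le, hs1]

/-- Functions agreeing almost everywhere on `(0,1)` have radial extensions agreeing almost
everywhere on the disc. -/
theorem ae_eq_comp_norm_ball {u v : ℝ → ℝ} (huv : u =ᵐ[volume.restrict (Ioo 0 1)] v) :
    (fun ζ : ℂ => u ‖ζ‖) =ᵐ[volume.restrict (Metric.ball (0 : ℂ) 1)] fun ζ => v ‖ζ‖ := by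
  obtain ⟨N, hN, hNm, hN0⟩ := exists_measurable_superset_of_null (ae_iff.1 huv)
  have hpre : MeasurableSet ((fun ζ : ℂ => ‖ζ‖) ⁻¹' N) := measurable_norm hNm
  refine ae_iff.2 (measure_mono_null (t := (fun ζ : ℂ => ‖ζ‖) ⁻¹' N) (fun ζ hζ => hN hζ) ?_)
  rw [← lintegral_indicator_one hpre, setLIntegral_ball_eq (measurable_one.indicator hpre)]
  rw [← compl_compl N] at hN0
  refine lintegral_eq_zero_of_ae_eq_zero ?_
  filter_upwards [ae_restrict_mem measurableSet_Ioo, mem_ae_iff.2 hN0] with s hs hsN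
  have hsN' : s ∉ N := hsN
  simp [Set.indicator, norm_circlePt hs.1.le, hsN']

/-- The maximal Bergman projection in polar coordinates, rotated to the positive radius. -/
theorem PomegaPlusL_circlePt {ω v : ℝ → ℝ} (hv : Measurable v)
    (hωv : ω =ᵐ[volume.restrict (Ioo 0 1)] v) {f : ℂ → ℂ} (hf : Measurable f) (r t : ℝ) :
    PomegaPlusL ω f (circlePt r t) =
      ∫⁻ s in Ioo (0 : ℝ) 1, ∫⁻ θ in Ioo (0 : ℝ) (2 * Real.pi),
        2 * ENNReal.ofReal (1 / (2 * Real.pi)) * ENNReal.ofReal (s * v s) *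
          ‖bergmanKernel ω r (circlePt s θ)‖ₑ * ‖f (circlePt s (θ + t))‖ₑ := by
  have hcongr : PomegaPlusL ω f (circlePt r t) = ∫⁻ ζ in Metric.ball (0 : ℂ) 1,
      ENNReal.ofReal (‖f ζ‖ * ‖bergmanKernel ω (circlePt r t) ζ‖ * v ‖ζ‖ / Real.pi) := by
    refine lintegral_congr_ae ?_
    filter_upwards [ae_eq_comp_norm_ball hωv] with ζ hζ
    rw [hζ]
  have hB := measurable_bergmanKernel ω (circlePt r t)
  rw [hcongr, setLIntegral_ball_eq (by fun_prop)]
  refine setLIntegral_congr_fun measurableSet_Ioo fun s hs => ?_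
  have hper : Function.Periodic (fun θ => ENNReal.ofReal (‖f (circlePt s θ)‖ *
      ‖bergmanKernel ω (circlePt r t) (circlePt s θ)‖ * v ‖circlePt s θ‖ / Real.pi))
      (2 * Real.pi) := fun θ => by simp only [circlePt_periodic s θ]
  rw [← hper.setLIntegral_Ioo_add_right Real.two_pi_pos t,
    ← lintegral_const_mul' _ _ ENNReal.ofReal_ne_top]
  refine lintegral_congr fun θ => ?_
  rw [bergmanKernel_circlePt, norm_circlePt hs.1.le, ← ofReal_norm, ← ofReal_norm,
    show (2 : ℝ≥0∞) = ENNReal.ofReal 2 by simp, ← ENNReal.ofReal_mul hs.1.le,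
    ← ENNReal.ofReal_mul zero_le_two, ← ENNReal.ofReal_mul (by positivity),
    ← ENNReal.ofReal_mul' (norm_nonneg _), ← ENNReal.ofReal_mul' (norm_nonneg _)]
  congr 1
  field_simp

/-- Integral means are homogeneous and invariant under rotations. -/
theorem lintegral_const_mul_circlePt_rpow {p : ℝ} (hp : 0 < p) (f : ℂ → ℂ) (s θ : ℝ)
    {a : ℝ≥0∞} (ha : a ≠ ⊤) :
    ENNReal.ofReal (1 / (2 * Real.pi)) ^ (1 / p) *
        (∫⁻ t in Ioo 0 (2 * Real.pi), (a * ‖f (circlePt s (θ + t))‖ₑ) ^ p) ^ (1 / p) =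
      a * MpE p s f := by
  have hpi : 0 ≤ 1 / p := by positivity
  have hper : Function.Periodic (fun t => ‖f (circlePt s t)‖ₑ ^ p) (2 * Real.pi) :=
    (circlePt_periodic s).comp fun z => ‖f z‖ₑ ^ p
  have hshift := hper.setLIntegral_Ioo_add_right Real.two_pi_pos θ
  simp_rw [ENNReal.mul_rpow_of_nonneg _ _ hp.le, add_comm θ]
  rw [lintegral_const_mul' _ _ (ENNReal.rpow_ne_top_of_nonneg hp.le ha), hshift,
    ENNReal.mul_rpow_of_nonneg _ _ hpi, ← ENNReal.rpow_mul, mul_one_div_cancel hp.ne',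
    ENNReal.rpow_one, MpE, ENNReal.mul_rpow_of_nonneg _ _ hpi, mul_left_comm]
  simp_rw [← ENNReal.ofReal_rpow_of_nonneg (norm_nonneg _) hp.le, ofReal_norm]

theorem measurable_MpE {f : ℂ → ℂ} (hf : Measurable f) (p : ℝ) :
    Measurable fun s => MpE p s f := by
  have h : Measurable fun x : ℝ × ℝ => ENNReal.ofReal (‖f (circlePt x.1 x.2)‖ ^ p) :=
    ((hf.comp measurable_circlePt).norm.pow_const p).ennreal_ofReal
  exact (h.lintegral_prod_right'.const_mul _).pow_const _

/-- Minkowski/Hölder estimate: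
`M_p(r, P_ω⁺ f) ≤ 2 ∫_0^1 M_p(s,f) M₁(s,B^ω_r) s ω(s) ds` in `[0,∞]`. -/
theorem Mp_PomegaPlus_estimate
    (ω : ℝ → ℝ) (hω : IsRadialWeight ω)
    (hpos : ∀ r ∈ Set.Ico (0:ℝ) 1, 0 < omegaHat ω r)
    (p : ℝ) (hp : 1 ≤ p)
    (f : ℂ → ℂ) (hf : Measurable f)
    (r : ℝ) (hr : r ∈ Set.Ico (0:ℝ) 1) :
    MpEE p r (PomegaPlusL ω f) ≤
      2 * ∫⁻ s in Set.Ioo (0:ℝ) 1,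
        MpE p s f * MpE 1 s (fun z => bergmanKernel ω ((r:ℝ) : ℂ) z) *
          ENNReal.ofReal (s * ω s) := by
  have hp0 : 0 < p := by linarith
  have hpi : 0 ≤ 1 / p := by positivity
  have hωm : AEMeasurable ω (volume.restrict (Ioo 0 1)) :=
    (hω.2.mono_set Ioo_subset_Ico_self).aemeasurable
  obtain ⟨v, hv, hωv⟩ : ∃ v, Measurable v ∧ ω =ᵐ[volume.restrict (Ioo 0 1)] v := hωm
  set κ : ℝ≥0∞ := ENNReal.ofReal (1 / (2 * Real.pi))
  set c : ℝ → ℝ≥0∞ := fun s => 2 * κ * ENNReal.ofReal (s * v s) with hc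
  have hct (s) : c s ≠ ⊤ := by finiteness
  have hcm : Measurable c := by fun_prop
  have hB := measurable_bergmanKernel ω r
  have hBp : Measurable fun x : ℝ × ℝ => ‖bergmanKernel ω r (circlePt x.1 x.2)‖ₑ :=
    (hB.comp measurable_circlePt).enorm
  set I : Measure ℝ := volume.restrict (Ioo 0 1)
  set J : Measure ℝ := volume.restrict (Ioo 0 (2 * Real.pi))
  set H : ℝ × ℝ → ℝ → ℝ≥0∞ := fun x t =>
    c x.1 * ‖bergmanKernel ω r (circlePt x.1 x.2)‖ₑ * ‖f (circlePt x.1 (x.2 + t))‖ₑ with hHdef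
  have hH : Measurable (Function.uncurry H) := by
    have h1 : Measurable fun z : (ℝ × ℝ) × ℝ => circlePt z.1.1 (z.1.2 + z.2) :=
      measurable_circlePt.comp (f := fun z : (ℝ × ℝ) × ℝ => (z.1.1, z.1.2 + z.2)) (by fun_prop)
    exact ((hcm.comp (measurable_fst.comp measurable_fst)).mul (hBp.comp measurable_fst)).mul
      (hf.comp h1).enorm
  have hP (t) : PomegaPlusL ω f (circlePt r t) = ∫⁻ x, H x t ∂(I.prod J) := by
    have hHt : Measurable fun x => H x t := hH.of_uncurry_right
    rw [PomegaPlusL_circlePt hv hωv hf, lintegral_prod _ hHt.aemeasurable]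
  have hinner (x : ℝ × ℝ) : κ ^ (1 / p) * (∫⁻ t, H x t ^ p ∂J) ^ (1 / p) =
      c x.1 * ‖bergmanKernel ω r (circlePt x.1 x.2)‖ₑ * MpE p x.1 f :=
    lintegral_const_mul_circlePt_rpow hp0 f x.1 x.2 (ENNReal.mul_ne_top (hct _) enorm_ne_top)
  have hMm := measurable_MpE hf p
  have hNm : Measurable fun x : ℝ × ℝ => (∫⁻ t, H x t ^ p ∂J) ^ (1 / p) :=
    (hH.pow_const p).lintegral_prod_right'.pow_const _
  calc MpEE p r (PomegaPlusL ω f)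
      = κ ^ (1 / p) * (∫⁻ t, (∫⁻ x, H x t ∂(I.prod J)) ^ p ∂J) ^ (1 / p) := by
        rw [MpEE, ENNReal.mul_rpow_of_nonneg _ _ hpi]
        simp_rw [hP]
        rfl
    _ ≤ κ ^ (1 / p) * ∫⁻ x, (∫⁻ t, H x t ^ p ∂J) ^ (1 / p) ∂(I.prod J) := by
        gcongr
        exact lintegral_rpow_lintegral_le _ _ hH hp
    _ = ∫⁻ x, c x.1 * ‖bergmanKernel ω r (circlePt x.1 x.2)‖ₑ * MpE p x.1 f ∂(I.prod J) := by
        rw [← lintegral_const_mul _ hNm]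
        simp_rw [hinner]
    _ = ∫⁻ s, c s * (∫⁻ θ, ‖bergmanKernel ω r (circlePt s θ)‖ₑ ∂J) * MpE p s f ∂I := by
        have hcB : Measurable fun x : ℝ × ℝ =>
            c x.1 * ‖bergmanKernel ω r (circlePt x.1 x.2)‖ₑ * MpE p x.1 f := by
          fun_prop
        rw [lintegral_prod _ hcB.aemeasurable]
        refine lintegral_congr fun s => ?_
        have hBs : Measurable fun θ => ‖bergmanKernel ω r (circlePt s θ)‖ₑ :=
          (hB.comp (measurable_circlePt_right s)).enorm
        dsimp only
        rw [lintegral_mul_const _ (hBs.const_mul _), lintegral_const_mul _ hBs]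
    _ = _ := by
        rw [← lintegral_const_mul' _ _ ENNReal.ofNat_ne_top]
        refine lintegral_congr_ae ?_
        filter_upwards [hωv] with s hs
        simp only [MpE, hs, hc, Real.rpow_one, ofReal_norm, ne_eq, one_ne_zero,
          not_false_eq_true, div_self, ENNReal.rpow_one]
        ring
end
end
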